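/- arXiv:2311.13891 — 5 statements merged into one kernel-verified Lean document; each statement's English description precedes it below -/
import Mathlib

section
/- Let N ≥ 2 be an integer and define, for a real number x ∈ (1, N], h(x) = 1 + ⌊(1/(k+1))·(2(x−1) − (2/k)·(N − ⌊(N+1)/2⌋))⌋ where k is the unique integer with N/k < x ≤ N/(k−1). Then h is nondecreasing on the integers of [2, N]: for every integer x with 3 ≤ x ≤ N, h(x−1) ≤ h(x). -/
/-- The cleared-denominator form of the monotonicity inequality, where `m` plays the role of
`N - ⌊(N+1)/2⌋`. -/
theorem monotone_numerator_bound {N m x k l : ℤ} (hm : 2 * m ≤ N) (hx : 3 ≤ x) (hk : 2 ≤ k)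
    (hl : 2 ≤ l) (hkx : N < k * x) (hkx' : x * (k - 1) ≤ N) (hlx : N < (x - 1) * l)
    (hlx' : (x - 1) * (l - 1) ≤ N) :
    (l * (x - 2) - m) * (k * (k + 1)) ≤ (k * (x - 1) - m) * (l * (l + 1)) := by
  have hkl : k ≤ l := by
    by_contra! h
    nlinarith
  have hlk : l ≤ 2 * k + 1 := by
    by_contra! h
    nlinarith
  have key : x * (l - k) * (l + k + 1) ≤ 2 * l * ((x - 2) * (l - k) + l + 1) := by
    rcases hkl.eq_or_lt with rfl | h
    · nlinarith
    · have h₁ : 0 ≤ x * ((l - k) * (l - k - 1)) :=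
        mul_nonneg (by lia) (mul_nonneg (by lia) (by lia))
      have h₂ : 0 ≤ l * (2 * k + 1 - l) := mul_nonneg (by lia) (by lia)
      linarith
  have h₁ : 2 * m * ((l - k) * (l + k + 1)) ≤ k * x * ((l - k) * (l + k + 1)) :=
    mul_le_mul_of_nonneg_right (by lia) (mul_nonneg (by lia) (by lia))
  have h₂ := mul_le_mul_of_nonneg_left key (by lia : 0 ≤ k)
  linarith

/-- Monotonicity of the bound function `h` from Theorem 3.3: for integers `3 ≤ x ≤ N`,
`h(x-1) ≤ h(x)`, where `h(y) = 1 + ⌊(2(y-1) - (2/k)(N - ⌊(N+1)/2⌋))/(k+1)⌋` and `k` is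
the unique integer with `N/k < y ≤ N/(k-1)`. Here `k` (resp. `k'`) is the parameter
associated with `x` (resp. `x - 1`). -/
theorem h_monotone (N : ℤ) (hN : 2 ≤ N) (x : ℤ) (hx3 : 3 ≤ x) (hxN : x ≤ N)
    (k k' : ℤ) (hk : 2 ≤ k)
    (hk1 : (N : ℝ) / (k : ℝ) < (x : ℝ)) (hk2 : (x : ℝ) ≤ (N : ℝ) / ((k : ℝ) - 1))
    (hk' : 2 ≤ k')
    (hk1' : (N : ℝ) / (k' : ℝ) < (x : ℝ) - 1) (hk2' : (x : ℝ) - 1 ≤ (N : ℝ) / ((k' : ℝ) - 1)) :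
    1 + ⌊(2 * (((x : ℝ) - 1) - 1) - 2 / (k' : ℝ) * ((N : ℝ) - ((N + 1) / 2 : ℤ))) / ((k' : ℝ) + 1)⌋ ≤
      1 + ⌊(2 * ((x : ℝ) - 1) - 2 / (k : ℝ) * ((N : ℝ) - ((N + 1) / 2 : ℤ))) / ((k : ℝ) + 1)⌋ := by
  have hkR : (2 : ℝ) ≤ k := by exact_mod_cast hk
  have hlR : (2 : ℝ) ≤ k' := by exact_mod_cast hk'
  rw [div_lt_iff₀ (by linarith)] at hk1 hk1'
  rw [le_div_iff₀ (by linarith)] at hk2 hk2'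
  have hkx : N < k * x := by rw [mul_comm]; exact_mod_cast hk1
  have hkx' : x * (k - 1) ≤ N := by exact_mod_cast hk2
  have hlx : N < (x - 1) * k' := by exact_mod_cast hk1'
  have hlx' : (x - 1) * (k' - 1) ≤ N := by exact_mod_cast hk2'
  have key := monotone_numerator_bound (m := N - (N + 1) / 2) (by lia) hx3 hk hk'
    hkx hkx' hlx hlx'
  have keyR : ((k' : ℝ) * (x - 2) - (N - ((N + 1) / 2 : ℤ))) * (k * (k + 1)) ≤
      (k * (x - 1) - (N - ((N + 1) / 2 : ℤ))) * (k' * (k' + 1)) := by exact_mod_cast key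
  generalize (N : ℝ) - ((N + 1) / 2 : ℤ) = m at keyR ⊢
  have clear_denom (y j : ℝ) (hj : 2 ≤ j) :
      (2 * y - 2 / j * m) / (j + 1) = 2 * ((j * y - m) / (j * (j + 1))) := by
    field_simp
  gcongr 1 + ⌊?_⌋
  rw [clear_denom _ _ hkR, clear_denom _ _ hlR]
  gcongr 2 * ?_
  rw [div_le_div_iff₀ (by positivity) (by positivity)]
  linarith
end

section
/- Let A be a nonempty compact subset of ℝ with λ(A) > 0 and diameter d = max(A) − min(A). Assume λ(A + A) = d + λ(A) < 3λ(A). Then A can be partitioned as A = min(A) + (A₁ ∪ I ∪ (d − A₂)) where: I is an interval of measure λ(I) = 2λ(A) − d; and for i = 1, 2, inf(A_i) = 0, λ(A_i) = diam(A_i)/2, and λ((A_i + A_i) ∩ [0, diam(A_i)]) = λ(A_i). -/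
open MeasureTheory Pointwise Set

theorem measure_preimage_const_sub (c : ℝ) (T : Set ℝ) :
    volume ((fun t => c - t) ⁻¹' T) = volume T :=
  (volume.measurePreserving_sub_left c).measure_preimage_emb
    (MeasurableEquiv.subLeft c).measurableEmbedding T

/-- A subset of `[u, v]` filling more than half of it represents `u + v` as a sum. -/
theorem add_mem_add_of_lt_two_mul_measure {T : Set ℝ} {u v : ℝ} (hT : MeasurableSet T)
    (huv : u ≤ v) (hsub : T ⊆ Icc u v) (h : v - u < 2 * volume.real T) : u + v ∈ T + T := by
  by_contra hmem
  have hR : volume.real ((fun t => (u + v) - t) ⁻¹' T) = volume.real T := by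
    rw [measureReal_def, measure_preimage_const_sub, measureReal_def]
  have hRm : MeasurableSet ((fun t => (u + v) - t) ⁻¹' T) :=
    hT.preimage (measurable_const.sub measurable_id)
  have hRsub : (fun t => (u + v) - t) ⁻¹' T ⊆ Icc u v := by
    intro t ht
    have := hsub ht
    simp only [mem_Icc] at this ⊢
    constructor <;> linarith [this.1, this.2]
  have hdisj : Disjoint T ((fun t => (u + v) - t) ⁻¹' T) := by
    rw [Set.disjoint_left]
    intro t ht ht'
    exact hmem ⟨t, ht, _, ht', by ring⟩
  have hfin : volume (Icc u v) ≠ ⊤ := measure_Icc_lt_top.ne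
  have hU := measureReal_union (μ := volume) hdisj hRm
    (measure_ne_top_of_subset hsub hfin) (measure_ne_top_of_subset hRsub hfin)
  have hle : volume.real (T ∪ (fun t => (u + v) - t) ⁻¹' T) ≤ volume.real (Icc u v) :=
    measureReal_mono (union_subset hsub hRsub) hfin
  rw [Real.volume_real_Icc_of_le huv] at hle
  linarith

/-- How much the measure of `A ∩ [0, x]` exceeds half the length of `[0, x]`. -/
noncomputable def halfExcess (A : Set ℝ) (x : ℝ) : ℝ := volume.real (A ∩ Icc 0 x) - x / 2

theorem halfExcess_sub {A : Set ℝ} (hA : MeasurableSet A) {x y : ℝ} (hx : 0 ≤ x) (hxy : x ≤ y) :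
    halfExcess A y - halfExcess A x = volume.real (A ∩ Ioc x y) - (y - x) / 2 := by
  have hU : A ∩ Icc 0 y = (A ∩ Icc 0 x) ∪ (A ∩ Ioc x y) := by
    rw [← inter_union_distrib_left, Icc_union_Ioc_eq_Icc hx hxy]
  have hdisj : Disjoint (A ∩ Icc 0 x) (A ∩ Ioc x y) := by
    rw [Set.disjoint_left]
    rintro t ⟨-, ht⟩ ⟨-, ht'⟩
    exact absurd ht.2 (not_le.2 ht'.1)
  have := measureReal_union (μ := volume) hdisj (hA.inter measurableSet_Ioc)
    (measure_ne_top_of_subset inter_subset_right measure_Icc_lt_top.ne)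
    (measure_ne_top_of_subset inter_subset_right measure_Ioc_lt_top.ne)
  unfold halfExcess
  rw [hU, this]
  ring

theorem abs_halfExcess_sub_le {A : Set ℝ} (hA : MeasurableSet A) {x y : ℝ} (hx : 0 ≤ x)
    (hxy : x ≤ y) : |halfExcess A y - halfExcess A x| ≤ (y - x) / 2 := by
  rw [halfExcess_sub hA hx hxy]
  have h1 : volume.real (A ∩ Ioc x y) ≤ volume.real (Ioc x y) :=
    measureReal_mono inter_subset_right measure_Ioc_lt_top.ne
  rw [Real.volume_real_Ioc_of_le hxy] at h1
  have h2 : 0 ≤ volume.real (A ∩ Ioc x y) := measureReal_nonneg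
  rw [abs_le]
  constructor <;> linarith

theorem continuousOn_halfExcess {A : Set ℝ} (hA : MeasurableSet A) :
    ContinuousOn (halfExcess A) (Ici 0) := by
  have : LipschitzOnWith 1 (halfExcess A) (Ici 0) := by
    refine LipschitzOnWith.of_dist_le_mul fun x hx y hy => ?_
    rw [Real.dist_eq, Real.dist_eq, NNReal.coe_one, one_mul]
    rcases le_total x y with h | h
    · rw [abs_sub_comm, abs_sub_comm x y, abs_of_nonneg (sub_nonneg.2 h)]
      linarith [abs_halfExcess_sub_le hA hx h]
    · rw [abs_of_nonneg (sub_nonneg.2 h)]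
      linarith [abs_halfExcess_sub_le hA hy h]
  exact this.continuousOn

theorem halfExcess_zero (A : Set ℝ) : halfExcess A 0 = 0 := by
  have h : volume.real (A ∩ Icc (0 : ℝ) 0) = 0 := by
    rw [measureReal_def, measure_mono_null inter_subset_right (by simp), ENNReal.toReal_zero]
  rw [halfExcess, h, zero_div, sub_zero]

theorem halfExcess_sub_of_ae_subset {A : Set ℝ} (hA : MeasurableSet A) {x y : ℝ} (hx : 0 ≤ x)
    (hxy : x ≤ y) (h : volume (Ioo x y \ A) = 0) :
    halfExcess A y - halfExcess A x = (y - x) / 2 := by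
  have h1 : volume.real (Ioo x y) ≤ volume.real (A ∩ Ioc x y) := by
    refine ENNReal.toReal_mono
      (measure_ne_top_of_subset inter_subset_right measure_Ioc_lt_top.ne) ?_
    calc volume (Ioo x y) ≤ volume (A ∩ Ioc x y ∪ Ioo x y \ A) := by
          refine measure_mono fun t ht => ?_
          by_cases htA : t ∈ A
          · exact Or.inl ⟨htA, Ioo_subset_Ioc_self ht⟩
          · exact Or.inr ⟨ht, htA⟩
      _ ≤ volume (A ∩ Ioc x y) + volume (Ioo x y \ A) := measure_union_le _ _
      _ = volume (A ∩ Ioc x y) := by rw [h, add_zero]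
  rw [Real.volume_real_Ioo_of_le hxy] at h1
  have h2 := (abs_le.1 (abs_halfExcess_sub_le hA hx hxy)).2
  have h3 := halfExcess_sub hA hx hxy
  linarith

section Normalized

variable {A : Set ℝ} {d : ℝ}

theorem mem_add_of_halfExcess_pos (hA : MeasurableSet A) {x : ℝ} (hx : 0 ≤ x)
    (h : 0 < halfExcess A x) :
    x ∈ A + A := by
  have := add_mem_add_of_lt_two_mul_measure (hA.inter measurableSet_Icc) hx
    (inter_subset_right (s := A) (t := Icc 0 x)) (by unfold halfExcess at h; linarith)
  rw [zero_add] at this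
  exact add_subset_add inter_subset_left inter_subset_left this

theorem add_mem_add_of_halfExcess_lt (hA : MeasurableSet A) {x : ℝ} (hx : 0 ≤ x) (hxd : x ≤ d)
    (h : halfExcess A x < halfExcess A d) : x + d ∈ A + A := by
  have h1 := halfExcess_sub hA hx hxd
  have := add_mem_add_of_lt_two_mul_measure (hA.inter measurableSet_Ioc) hxd
    ((inter_subset_right (s := A) (t := Ioc x d)).trans Ioc_subset_Icc_self) (by linarith)
  exact add_subset_add inter_subset_left inter_subset_left this

/-- If `A + A` has the critical measure, then almost every residue in `[0, d)` which has both
representatives in `A + A` comes from `A`. -/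
theorem measure_double_residue_diff (hA : IsCompact A) (h0 : 0 ∈ A) (hdA : d ∈ A)
    (hsub : A ⊆ Icc 0 d) (hc : 0 < halfExcess A d)
    (hsum : volume.real (A + A) = d + volume.real A) :
    volume ({x | x ∈ Ico 0 d ∧ x ∈ A + A ∧ x + d ∈ A + A} \ A) = 0 := by
  have hd0 : 0 ≤ d := (hsub h0).2
  have hAm := hA.measurableSet
  have hSm : MeasurableSet (A + A) := (hA.add hA).measurableSet
  have hSsub : A + A ⊆ Icc 0 (2 * d) := by
    rintro _ ⟨a, ha, b, hb, rfl⟩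
    have h1 := hsub ha
    have h2 := hsub hb
    constructor
    · show 0 ≤ a + b
      linarith [h1.1, h2.1]
    · show a + b ≤ 2 * d
      linarith [h1.2, h2.2]
  set P := (A + A) ∩ Ico 0 d with hP
  set Q := ((fun x => x + d) ⁻¹' (A + A)) ∩ Ico 0 d with hQ
  have hPm : MeasurableSet P := hSm.inter measurableSet_Ico
  have hQm : MeasurableSet Q :=
    (hSm.preimage (measurable_id.add_const d)).inter measurableSet_Ico
  have hfin : volume (Ico 0 d) ≠ ⊤ := measure_Ico_lt_top.ne
  have hPfin : volume P ≠ ⊤ := measure_ne_top_of_subset inter_subset_right hfin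
  have hQfin : volume Q ≠ ⊤ := measure_ne_top_of_subset inter_subset_right hfin
  have hcover : P ∪ Q = Ico 0 d := by
    refine subset_antisymm (union_subset inter_subset_right inter_subset_right) fun x hx => ?_
    rcases lt_or_ge 0 (halfExcess A x) with h | h
    · exact Or.inl ⟨mem_add_of_halfExcess_pos hAm hx.1 h, hx⟩
    · exact Or.inr ⟨add_mem_add_of_halfExcess_lt hAm hx.1 hx.2.le (h.trans_lt hc), hx⟩
  have hPQ : volume.real P + volume.real Q = volume.real (A + A) := by
    have hQ' : volume Q = volume ((A + A) ∩ Ico d (2 * d)) := by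
      rw [← measure_preimage_add_right volume d ((A + A) ∩ Ico d (2 * d)), hQ]
      congr 1
      ext x
      simp only [mem_inter_iff, mem_preimage, mem_Ico]
      constructor <;> rintro ⟨h1, h2, h3⟩ <;> exact ⟨h1, by linarith, by linarith⟩
    have hU : (A + A : Set ℝ) =ᵐ[volume] (P ∪ (A + A) ∩ Ico d (2 * d) : Set ℝ) := by
      have h1 : P ∪ (A + A) ∩ Ico d (2 * d) = (A + A) ∩ Ico 0 (2 * d) := by
        rw [hP, ← inter_union_distrib_left, Ico_union_Ico_eq_Ico hd0 (by linarith)]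
      have h2 : (A + A) = (A + A) ∩ Icc 0 (2 * d) := (inter_eq_left.2 hSsub).symm
      rw [h1]
      nth_rewrite 1 [h2]
      exact (ae_eq_refl _).inter Ico_ae_eq_Icc.symm
    have hdisj : Disjoint P ((A + A) ∩ Ico d (2 * d)) := by
      rw [Set.disjoint_left]
      rintro t ⟨-, ht⟩ ⟨-, ht'⟩
      exact absurd ht.2 (not_lt.2 ht'.1)
    rw [measureReal_congr hU, measureReal_union hdisj (hSm.inter measurableSet_Ico) hPfin
      (by rw [← hQ']; exact hQfin), measureReal_def (s := Q), hQ', ← measureReal_def]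
  have hinter : volume.real (P ∩ Q) = volume.real A := by
    have := measureReal_union_add_inter (μ := volume) (s := P) hQm hPfin hQfin
    rw [hcover, Real.volume_real_Ico_of_le hd0] at this
    linarith
  have hAsub : A ∩ Ico 0 d ⊆ P ∩ Q := by
    rintro x ⟨hx, hx'⟩
    exact ⟨⟨⟨x, hx, 0, h0, add_zero x⟩, hx'⟩, ⟨x, hx, d, hdA, rfl⟩, hx'⟩
  have hAae : (A : Set ℝ) =ᵐ[volume] (A ∩ Ico 0 d : Set ℝ) := by
    have h2 : A = A ∩ Icc 0 d := (inter_eq_left.2 hsub).symm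
    nth_rewrite 1 [h2]
    exact (ae_eq_refl _).inter Ico_ae_eq_Icc.symm
  rw [measureReal_congr hAae] at hinter
  have hdiff := measureReal_sdiff (μ := volume) hAsub (hAm.inter measurableSet_Ico)
    (measure_ne_top_of_subset inter_subset_left hPfin)
  rw [hinter, sub_self, measureReal_eq_zero_iff
    (measure_ne_top_of_subset (sdiff_subset.trans inter_subset_left) hPfin)] at hdiff
  refine measure_mono_null ?_ hdiff
  rintro x ⟨⟨hx, h1, h2⟩, hxA⟩
  exact ⟨⟨⟨h1, hx⟩, h2, hx⟩, fun h => hxA h.1⟩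

/-- The half-excess never drops below a level strictly between `0` and its final value. -/
theorem le_halfExcess_of_le (hA : MeasurableSet A)
    (hnull : ∀ x y, 0 ≤ x → x ≤ y → y ≤ d →
      (∀ t ∈ Ioo x y, 0 < halfExcess A t ∧ halfExcess A t < halfExcess A d) →
      halfExcess A y - halfExcess A x = (y - x) / 2)
    {s x y : ℝ} (hs : 0 < s) (hsd : s < halfExcess A d) (hx : 0 ≤ x) (hxy : x ≤ y)
    (hyd : y ≤ d) (h : s ≤ halfExcess A x) : s ≤ halfExcess A y := by
  have hcont : ContinuousOn (halfExcess A) (Icc x y) :=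
    (continuousOn_halfExcess hA).mono fun t ht => hx.trans ht.1
  have hK : IsCompact (Icc x y ∩ halfExcess A ⁻¹' Ici s) :=
    isCompact_Icc.of_isClosed_subset (hcont.preimage_isClosed_of_isClosed isClosed_Icc isClosed_Ici)
      inter_subset_left
  obtain ⟨z, ⟨hz, hsz⟩, hmax⟩ := hK.exists_isGreatest ⟨x, left_mem_Icc.2 hxy, h⟩
  rcases hz.2.eq_or_lt with rfl | hzy
  · exact hsz
  have hsz : s ≤ halfExcess A z := hsz
  have hz0 : 0 ≤ z := hx.trans hz.1
  have hlt : ∀ t, z < t → t ≤ y → halfExcess A t < s := by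
    intro t hzt hty
    by_contra hcon
    exact absurd (hmax ⟨⟨hz.1.trans hzt.le, hty⟩, not_lt.1 hcon⟩) (not_le.2 hzt)
  obtain ⟨w, hzw, hw⟩ := exists_between (lt_min hzy (show z < z + s by linarith))
  have hwy : w < y := hw.trans_le (min_le_left _ _)
  have hws : w < z + s := hw.trans_le (min_le_right _ _)
  have := hnull z w hz0 hzw.le (hwy.le.trans hyd) fun t ht => by
    have h1 := (abs_le.1 (abs_halfExcess_sub_le hA hz0 ht.1.le)).1
    exact ⟨by linarith [ht.2], (hlt t ht.1 (ht.2.trans hwy).le).trans hsd⟩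
  linarith [hlt w hzw hwy.le]

/-- The structure of `A` in terms of the two endpoints of its interval part. -/
theorem exists_critical_endpoints (hA : IsCompact A) (h0 : 0 ∈ A) (hdA : d ∈ A)
    (hsub : A ⊆ Icc 0 d) (hc : 0 < halfExcess A d)
    (hsum : volume.real (A + A) = d + volume.real A) :
    ∃ b e, 0 ≤ b ∧ b < e ∧ e ≤ d ∧ Icc b e ⊆ A ∧ e - b = 2 * halfExcess A d ∧
      halfExcess A b = 0 ∧ halfExcess A e = halfExcess A d ∧
      (∀ t ∈ Icc 0 b, halfExcess A t < halfExcess A d) ∧ ∀ t ∈ Icc e d, 0 < halfExcess A t := by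
  have hd0 : 0 ≤ d := (hsub h0).2
  have hAm := hA.measurableSet
  have hcont := continuousOn_halfExcess hAm
  have hzero : ∀ x y, 0 ≤ x → y ≤ d →
      (∀ t ∈ Ioo x y, 0 < halfExcess A t ∧ halfExcess A t < halfExcess A d) →
      volume (Ioo x y \ A) = 0 := by
    intro x y hx hy h
    refine measure_mono_null ?_ (measure_double_residue_diff hA h0 hdA hsub hc hsum)
    rintro t ⟨ht, htA⟩
    have h1 : 0 ≤ t := hx.trans ht.1.le
    have h2 : t < d := ht.2.trans_le hy
    exact ⟨⟨⟨h1, h2⟩, mem_add_of_halfExcess_pos hAm h1 (h t ht).1,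
      add_mem_add_of_halfExcess_lt hAm h1 h2.le (h t ht).2⟩, htA⟩
  have hnull : ∀ x y, 0 ≤ x → x ≤ y → y ≤ d →
      (∀ t ∈ Ioo x y, 0 < halfExcess A t ∧ halfExcess A t < halfExcess A d) →
      halfExcess A y - halfExcess A x = (y - x) / 2 := fun x y hx hxy hy h =>
    halfExcess_sub_of_ae_subset hAm hx hxy (hzero x y hx hy h)
  have hK : IsCompact (Icc 0 d ∩ halfExcess A ⁻¹' Iic 0) :=
    isCompact_Icc.of_isClosed_subset ((hcont.mono fun t ht => ht.1).preimage_isClosed_of_isClosed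
      isClosed_Icc isClosed_Iic) inter_subset_left
  obtain ⟨b, ⟨hb, hb0⟩, hbmax⟩ :=
    hK.exists_isGreatest ⟨0, left_mem_Icc.2 hd0, (halfExcess_zero A).le⟩
  have hb0 : halfExcess A b ≤ 0 := hb0
  have hpos : ∀ t, b < t → t ≤ d → 0 < halfExcess A t := by
    intro t hbt htd
    by_contra hcon
    exact absurd (hbmax ⟨⟨hb.1.trans hbt.le, htd⟩, not_lt.1 hcon⟩) (not_le.2 hbt)
  have hbzero : halfExcess A b = 0 := by
    obtain ⟨t, ht, ht0⟩ := intermediate_value_Icc hb.2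
      (hcont.mono fun t ht => hb.1.trans ht.1) ⟨hb0, hc.le⟩
    have : t ≤ b := hbmax ⟨⟨hb.1.trans ht.1, ht.2⟩, ht0.le⟩
    rw [← le_antisymm this ht.1, ht0]
  have hcont' : ContinuousOn (halfExcess A) (Icc b d) := hcont.mono fun t ht => hb.1.trans ht.1
  have hK' : IsCompact (Icc b d ∩ halfExcess A ⁻¹' Ici (halfExcess A d)) :=
    isCompact_Icc.of_isClosed_subset (hcont'.preimage_isClosed_of_isClosed
      isClosed_Icc isClosed_Ici) inter_subset_left
  obtain ⟨e, ⟨he, hec⟩, hemin⟩ := hK'.exists_isLeast ⟨d, right_mem_Icc.2 hb.2, le_refl (halfExcess A d)⟩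
  have hec : halfExcess A d ≤ halfExcess A e := hec
  have heeq : halfExcess A e = halfExcess A d := by
    obtain ⟨t, ht, ht0⟩ := intermediate_value_Icc he.1
      (hcont'.mono fun t ht => ⟨ht.1, ht.2.trans he.2⟩) ⟨hbzero.le.trans hc.le, hec⟩
    have : e ≤ t := hemin ⟨⟨ht.1, ht.2.trans he.2⟩, ht0.ge⟩
    rw [le_antisymm this ht.2, ht0]
  have hbe : b < e := by
    refine he.1.lt_of_ne fun h => ?_
    rw [← h, hbzero] at heeq
    exact hc.ne heeq
  have hmid : ∀ t ∈ Ioo b e, 0 < halfExcess A t ∧ halfExcess A t < halfExcess A d := by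
    intro t ht
    refine ⟨hpos t ht.1 (ht.2.le.trans he.2), ?_⟩
    by_contra hcon
    exact absurd (hemin ⟨⟨ht.1.le, ht.2.le.trans he.2⟩, not_lt.1 hcon⟩) (not_le.2 ht.2)
  have hIoo : Ioo b e ⊆ A := by
    have hopen : IsOpen (Ioo b e \ A) := isOpen_Ioo.sdiff hA.isClosed
    exact sdiff_eq_empty.1 ((hopen.measure_eq_zero_iff volume).1 (hzero b e hb.1 he.2 hmid))
  refine ⟨b, e, hb.1, hbe, he.2, ?_, ?_, hbzero, heeq, ?_, fun t ht =>
    hpos t (hbe.trans_le ht.1) ht.2⟩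
  · rw [← closure_Ioo hbe.ne]
    exact hA.isClosed.closure_subset_iff.2 hIoo
  · have := hnull b e hb.1 hbe.le he.2 hmid
    rw [heeq, hbzero] at this
    linarith
  · intro t ht
    by_contra hcon
    have := le_halfExcess_of_le hAm hnull (s := halfExcess A d / 2) (by linarith) (by linarith)
      ht.1 ht.2 hb.2 (by linarith [not_lt.1 hcon])
    linarith

/-- The structure theorem for sets with minimum `0` and maximum `d`. -/
theorem critical_set_structure_of_isLeast_zero (hA : IsCompact A) (h0 : 0 ∈ A) (hdA : d ∈ A)
    (hsub : A ⊆ Icc 0 d) (hsmall : d < 2 * volume.real A)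
    (hsum : volume.real (A + A) = d + volume.real A) :
    ∃ A₁ I A₂ : Set ℝ,
      A = A₁ ∪ I ∪ (fun t => d - t) '' A₂ ∧
      Disjoint A₁ I ∧ Disjoint A₁ ((fun t => d - t) '' A₂) ∧
        Disjoint I ((fun t => d - t) '' A₂) ∧
      I.OrdConnected ∧ volume I = ENNReal.ofReal (2 * volume.real A - d) ∧
      sInf A₁ = 0 ∧ volume.real A₁ = (sSup A₁ - sInf A₁) / 2 ∧
        volume ((A₁ + A₁) ∩ Icc 0 (sSup A₁ - sInf A₁)) = volume A₁ ∧
      sInf A₂ = 0 ∧ volume.real A₂ = (sSup A₂ - sInf A₂) / 2 ∧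
        volume ((A₂ + A₂) ∩ Icc 0 (sSup A₂ - sInf A₂)) = volume A₂ := by
  have hAm := hA.measurableSet
  have hexc : halfExcess A d = volume.real A - d / 2 := by
    rw [halfExcess, inter_eq_left.2 hsub]
  have hc : 0 < halfExcess A d := by linarith
  have hres := measure_double_residue_diff hA h0 hdA hsub hc hsum
  obtain ⟨b, e, hb0, hbe, hed, hIcc, hlen, hb, he, hleft, hright⟩ :=
    exists_critical_endpoints hA h0 hdA hsub hc hsum
  have hbA : b ∈ A := hIcc (left_mem_Icc.2 hbe.le)
  have heA : e ∈ A := hIcc (right_mem_Icc.2 hbe.le)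
  have himg : ∀ T : Set ℝ, (fun t => d - t) '' ((fun t => d - t) ⁻¹' T) = T := fun T =>
    image_preimage_eq T fun t => ⟨d - t, by ring⟩
  set A₂ : Set ℝ := (fun t => d - t) ⁻¹' (A ∩ Icc e d) with hA₂
  have hA₁least : IsLeast (A ∩ Icc 0 b) 0 := ⟨⟨h0, le_refl _, hb0⟩, fun t ht => ht.2.1⟩
  have hA₁greatest : IsGreatest (A ∩ Icc 0 b) b := ⟨⟨hbA, hb0, le_refl _⟩, fun t ht => ht.2.2⟩
  have hmemA₂ : ∀ t, t ∈ A₂ ↔ d - t ∈ A ∧ e ≤ d - t ∧ d - t ≤ d := fun t => Iff.rfl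
  have hA₂least : IsLeast A₂ 0 := by
    refine ⟨(hmemA₂ 0).2 ⟨by simpa using hdA, by linarith, by linarith⟩, fun t ht => ?_⟩
    linarith [((hmemA₂ t).1 ht).2.2]
  have hA₂greatest : IsGreatest A₂ (d - e) := by
    refine ⟨(hmemA₂ _).2 ⟨by simpa using heA, by linarith, by linarith⟩, fun t ht => ?_⟩
    linarith [((hmemA₂ t).1 ht).2.1]
  have hA₂vol : volume A₂ = volume (A ∩ Icc e d) := measure_preimage_const_sub d _
  refine ⟨A ∩ Icc 0 b, Ioo b e, A₂, ?_, ?_, ?_, ?_, ordConnected_Ioo, ?_, hA₁least.csInf_eq, ?_, ?_,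
    hA₂least.csInf_eq, ?_, ?_⟩
  · rw [himg]
    ext t
    constructor
    · intro ht
      have := hsub ht
      rcases le_or_gt t b with h | h
      · exact Or.inl (Or.inl ⟨ht, this.1, h⟩)
      · rcases lt_or_ge t e with h' | h'
        · exact Or.inl (Or.inr ⟨h, h'⟩)
        · exact Or.inr ⟨ht, h', this.2⟩
    · rintro ((ht | ht) | ht)
      · exact ht.1
      · exact hIcc (Ioo_subset_Icc_self ht)
      · exact ht.1
  · rw [Set.disjoint_left]
    rintro t ⟨-, ht⟩ ht'
    exact absurd ht.2 (not_le.2 ht'.1)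
  · rw [himg, Set.disjoint_left]
    rintro t ⟨-, ht⟩ ⟨-, ht'⟩
    linarith [ht.2, ht'.1]
  · rw [himg, Set.disjoint_left]
    rintro t ht ⟨-, ht'⟩
    exact absurd ht.2 (not_lt.2 ht'.1)
  · rw [Real.volume_Ioo, hlen, hexc]
    congr 1
    ring
  · rw [hA₁greatest.csSup_eq, hA₁least.csInf_eq]
    unfold halfExcess at hb
    linarith
  · rw [hA₁greatest.csSup_eq, hA₁least.csInf_eq, sub_zero]
    refine le_antisymm ?_ (measure_mono ?_)
    · refine measure_mono_ae (ae_le_set.2 (measure_mono_null ?_ hres))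
      rintro x ⟨⟨hx, hxb⟩, hxA⟩
      have hxd : x < d := by linarith [hxb.2]
      exact ⟨⟨⟨hxb.1, hxd⟩, add_subset_add inter_subset_left inter_subset_left hx,
        add_mem_add_of_halfExcess_lt hAm hxb.1 hxd.le (hleft x hxb)⟩, fun h => hxA ⟨h, hxb⟩⟩
    · exact fun x hx => ⟨⟨x, hx, 0, hA₁least.1, add_zero x⟩, hx.2⟩
  · rw [hA₂greatest.csSup_eq, hA₂least.csInf_eq, measureReal_def, hA₂vol, ← measureReal_def]
    have hIoc : volume.real (A ∩ Icc e d) = volume.real (A ∩ Ioc e d) :=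
      measureReal_congr ((ae_eq_refl _).inter Ioc_ae_eq_Icc.symm)
    have := halfExcess_sub hAm (hb0.trans hbe.le) hed
    linarith
  · rw [hA₂greatest.csSup_eq, hA₂least.csInf_eq, sub_zero]
    refine le_antisymm ?_ (measure_mono ?_)
    · have hres' : volume ((fun t => d - t) ⁻¹'
          ({x | x ∈ Ico 0 d ∧ x ∈ A + A ∧ x + d ∈ A + A} \ A) ∪ {0}) = 0 :=
        measure_union_null (by rw [measure_preimage_const_sub]; exact hres) (by simp)
      refine measure_mono_ae (ae_le_set.2 (measure_mono_null ?_ hres'))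
      rintro x ⟨⟨⟨p, hp, q, hq, hpq⟩, hx⟩, hxA⟩
      rcases hx.1.eq_or_lt with h | h
      · exact Or.inr h.symm
      have hde : e ≤ d - x := by linarith [hx.2]
      have hdd : d - x < d := by linarith
      refine Or.inl ⟨⟨⟨by linarith, hdd⟩,
        mem_add_of_halfExcess_pos hAm (by linarith) (hright _ ⟨hde, hdd.le⟩), d - p, hp.1, d - q, hq.1, ?_⟩,
        fun h' => hxA ⟨h', hde, hdd.le⟩⟩
      simp only at hpq ⊢
      linarith
    · refine fun x hx => ⟨⟨x, hx, 0, hA₂least.1, add_zero x⟩, hA₂least.2 hx, hA₂greatest.2 hx⟩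

end Normalized

/-- Theorem 2.1 (`critA_JEP`): structure of critical sets for Ruzsa's inequality in the
symmetric case: `A = min(A) + (A₁ ∪ I ∪ (d - A₂))`, a partition into three parts, where
`I` is an interval of measure `2λ(A) - d` and `A₁`, `A₂` are additively left-stable of
density `1/2` (in measure). -/
theorem critical_set_structure (A : Set ℝ) (hA : IsCompact A) (hne : A.Nonempty)
    (hpos : 0 < volume A) (d : ℝ) (hd : d = sSup A - sInf A)
    (hsum : (volume (A + A)).toReal = d + (volume A).toReal)
    (hsmall : d + (volume A).toReal < 3 * (volume A).toReal) :
    ∃ A₁ I A₂ : Set ℝ,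
      A = (fun t => sInf A + t) '' (A₁ ∪ I ∪ (fun t => d - t) '' A₂) ∧
      Disjoint A₁ I ∧ Disjoint A₁ ((fun t => d - t) '' A₂) ∧
        Disjoint I ((fun t => d - t) '' A₂) ∧
      I.OrdConnected ∧ volume I = ENNReal.ofReal (2 * (volume A).toReal - d) ∧
      sInf A₁ = 0 ∧ (volume A₁).toReal = (sSup A₁ - sInf A₁) / 2 ∧
        volume ((A₁ + A₁) ∩ Icc 0 (sSup A₁ - sInf A₁)) = volume A₁ ∧
      sInf A₂ = 0 ∧ (volume A₂).toReal = (sSup A₂ - sInf A₂) / 2 ∧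
        volume ((A₂ + A₂) ∩ Icc 0 (sSup A₂ - sInf A₂)) = volume A₂ := by
  set m := sInf A with hm
  have hmin : IsLeast A m := hA.isLeast_sInf hne
  have hmax : IsGreatest A (sSup A) := hA.isGreatest_sSup hne
  set B : Set ℝ := (fun t => -m + t) '' A with hB
  have hvol : ∀ (c : ℝ) (T : Set ℝ), volume ((fun t => c + t) '' T) = volume T := fun c T => by
    rw [image_add_left, measure_preimage_add]
  have hBA : volume.real B = (volume A).toReal := by rw [measureReal_def, hvol]
  have hBB : volume.real (B + B) = (volume (A + A)).toReal := by
    have : B + B = (fun t => (-m + -m) + t) '' (A + A) := by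
      ext x
      constructor
      · rintro ⟨_, ⟨p, hp, rfl⟩, _, ⟨q, hq, rfl⟩, rfl⟩
        exact ⟨p + q, ⟨p, hp, q, hq, rfl⟩, by ring⟩
      · rintro ⟨_, ⟨p, hp, q, hq, rfl⟩, rfl⟩
        exact ⟨-m + p, ⟨p, hp, rfl⟩, -m + q, ⟨q, hq, rfl⟩, by ring⟩
    rw [measureReal_def, this, hvol]
  have hBsub : B ⊆ Icc 0 d := by
    rintro _ ⟨a, ha, rfl⟩
    have h1 := hmin.2 ha
    have h2 := hmax.2 ha
    constructor
    · show 0 ≤ -m + a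
      linarith
    · show -m + a ≤ d
      linarith
  obtain ⟨A₁, I, A₂, hU, hrest⟩ := critical_set_structure_of_isLeast_zero (A := B) (d := d)
    (hA.image (continuous_const.add continuous_id)) ⟨m, hmin.1, by ring⟩
    ⟨sSup A, hmax.1, by rw [hd]; ring⟩ hBsub (by linarith) (by rw [hBB, hBA, hsum])
  rw [hBA] at hrest
  refine ⟨A₁, I, A₂, ?_, hrest⟩
  rw [← hU, hB, image_image]
  simp
end

section
/- Let A and B be compact subsets of ℝ with λ(A) > 0 and λ(B) > 0, and let K be the unique positive integer such that K(K−1)/2 ≤ λ(A)/λ(B) < K(K+1)/2. Then either λ(A + B) ≥ λ(A) + diam(B), where diam(B) = max(B) − min(B), or λ(A + B) ≥ (K+1)·(λ(A)/K + λ(B)/2). -/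
open MeasureTheory Pointwise Set

/-- The number of elements of `A` in the residue class `x` modulo `p`. -/
def residueCount (p : ℕ) (A : Finset ℤ) (x : ZMod p) : ℕ :=
  (A.filter fun a : ℤ => (a : ZMod p) = x).card

/-- The residue classes modulo `p` that contain more than `k` elements of `A`. -/
def richResidues (p : ℕ) [NeZero p] (A : Finset ℤ) (k : ℕ) : Finset (ZMod p) :=
  Finset.univ.filter fun x => k < residueCount p A x

section Residues

variable {p : ℕ} [NeZero p]

lemma mem_richResidues {A : Finset ℤ} {k : ℕ} {x : ZMod p} :
    x ∈ richResidues p A k ↔ k < residueCount p A x := by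
  simp [richResidues]

lemma richResidues_antitone (A : Finset ℤ) : Antitone (richResidues p A) := by
  intro k l hkl x hx
  rw [mem_richResidues] at hx ⊢
  omega

lemma card_eq_sum_residueCount (A : Finset ℤ) : A.card = ∑ x, residueCount p A x :=
  Finset.card_eq_sum_card_fiberwise fun _ _ => Finset.mem_coe.2 (Finset.mem_univ _)

lemma sum_card_richResidues (A : Finset ℤ) (N : ℕ) :
    ∑ k ∈ Finset.range N, (richResidues p A k).card = ∑ x, min N (residueCount p A x) := by
  simp only [richResidues, Finset.card_filter]
  rw [Finset.sum_comm]
  refine Finset.sum_congr rfl fun x _ => ?_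
  rw [← Finset.card_filter]
  have : (Finset.range N).filter (fun k => k < residueCount p A x) =
      Finset.range (min N (residueCount p A x)) := by
    ext k; simp
  rw [this, Finset.card_range]

lemma sum_card_richResidues_le (A : Finset ℤ) (N : ℕ) :
    ∑ k ∈ Finset.range N, (richResidues p A k).card ≤ A.card := by
  rw [sum_card_richResidues, card_eq_sum_residueCount (p := p)]
  exact Finset.sum_le_sum fun x _ => min_le_right _ _

lemma richResidues_subset_succ_add {A B : Finset ℤ} (h0 : 0 ∈ B) (hp : (p : ℤ) ∈ B) (k : ℕ) :
    richResidues p A k ⊆ richResidues p (A + B) (k + 1) := by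
  intro x hx
  rw [mem_richResidues] at hx ⊢
  set F := A.filter fun a : ℤ => (a : ZMod p) = x with hF
  have hne : F.Nonempty := Finset.card_pos.1 (by change 0 < residueCount p A x; omega)
  have hmem := Finset.mem_filter.1 (F.max'_mem hne)
  have hppos : (0 : ℤ) < p := by exact_mod_cast Nat.pos_of_ne_zero (NeZero.ne p)
  have hnot : F.max' hne + p ∉ F := fun h => by
    have := F.le_max' _ h
    omega
  have hsub : insert (F.max' hne + p) F ⊆ (A + B).filter fun a : ℤ => (a : ZMod p) = x := by
    intro y hy
    rcases Finset.mem_insert.1 hy with rfl | hy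
    · exact Finset.mem_filter.2 ⟨Finset.add_mem_add hmem.1 hp, by simp [hmem.2]⟩
    · have hy := Finset.mem_filter.1 hy
      exact Finset.mem_filter.2 ⟨by simpa using Finset.add_mem_add hy.1 h0, hy.2⟩
  have hcard := Finset.card_le_card hsub
  rw [Finset.card_insert_of_notMem hnot] at hcard
  have : k < F.card := hx
  change k + 1 < ((A + B).filter fun a : ℤ => (a : ZMod p) = x).card
  omega

lemma richResidues_add_subset (A B : Finset ℤ) (k : ℕ) :
    richResidues p A k + B.image (Int.cast : ℤ → ZMod p) ⊆ richResidues p (A + B) k := by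
  intro z hz
  obtain ⟨x, hx, y, hy, rfl⟩ := Finset.mem_add.1 hz
  obtain ⟨b, hb, rfl⟩ := Finset.mem_image.1 hy
  rw [mem_richResidues] at hx ⊢
  refine hx.trans_le ?_
  refine Finset.card_le_card_of_injOn (fun a => a + b) ?_ fun a _ c _ h => add_right_cancel h
  intro a ha
  have ha := Finset.mem_filter.1 ha
  exact Finset.mem_filter.2 ⟨Finset.add_mem_add ha.1 hb, by simp [ha.2]⟩

end Residues

lemma card_le_card_image_cast_add_one {p : ℕ} {B : Finset ℤ} (hB : B ⊆ Finset.Icc 0 (p : ℤ)) :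
    B.card ≤ (B.image (Int.cast : ℤ → ZMod p)).card + 1 := by
  have hinj : Set.InjOn (Int.cast : ℤ → ZMod p) (B.erase p) := by
    intro x hx y hy h
    have hx' := Finset.mem_erase.1 hx
    have hy' := Finset.mem_erase.1 hy
    have hx2 := Finset.mem_Icc.1 (hB hx'.2)
    have hy2 := Finset.mem_Icc.1 (hB hy'.2)
    have h := (ZMod.intCast_eq_intCast_iff _ _ _).1 h
    have h := Int.ModEq.eq h
    rwa [Int.emod_eq_of_lt hx2.1 (lt_of_le_of_ne hx2.2 hx'.1),
      Int.emod_eq_of_lt hy2.1 (lt_of_le_of_ne hy2.2 hy'.1)] at h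
  have h1 : (B.erase p).card ≤ (B.image (Int.cast : ℤ → ZMod p)).card := by
    rw [← Finset.card_image_of_injOn hinj]
    exact Finset.card_le_card (Finset.image_subset_image (Finset.erase_subset _ _))
  have h2 := Finset.pred_card_le_card_erase (s := B) (a := (p : ℤ))
  omega

/-- Convex combination of the lower bounds `a k + c ≤ s k` and `a k ≤ s (k + 1)`. -/
lemma weighted_layer_sum_le {n : ℕ} {a s : ℕ → ℝ} {c : ℝ} (h1 : ∀ k < n, a k + c ≤ s k)
    (h2 : ∀ k < n, a k ≤ s (k + 1)) :
    ((n : ℝ) + 1) * ∑ k ∈ Finset.range n, a k + n * (n + 1) / 2 * c ≤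
      n * ∑ k ∈ Finset.range (n + 1), s k := by
  have hs : (n : ℝ) * ∑ k ∈ Finset.range (n + 1), s k =
      ∑ k ∈ Finset.range n, (((n : ℝ) - k) * s k + (k + 1) * s (k + 1)) := by
    have e1 : ∑ k ∈ Finset.range (n + 1), ((n : ℝ) - k) * s k =
        ∑ k ∈ Finset.range n, ((n : ℝ) - k) * s k := by
      rw [Finset.sum_range_succ]; simp
    have e2 : ∑ k ∈ Finset.range (n + 1), (k : ℝ) * s k =
        ∑ k ∈ Finset.range n, ((k : ℝ) + 1) * s (k + 1) := by
      rw [Finset.sum_range_succ']; simp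
    rw [Finset.sum_add_distrib, ← e1, ← e2, ← Finset.sum_add_distrib, Finset.mul_sum]
    exact Finset.sum_congr rfl fun k _ => by ring
  have hc : ∀ m : ℕ, ∑ k ∈ Finset.range m, ((n : ℝ) - k) = n * m - m * (m - 1) / 2 := by
    intro m
    induction m with
    | zero => simp
    | succ m ih => rw [Finset.sum_range_succ, ih]; push_cast; ring
  have ha : ((n : ℝ) + 1) * ∑ k ∈ Finset.range n, a k + n * (n + 1) / 2 * c =
      ∑ k ∈ Finset.range n, (((n : ℝ) - k) * (a k + c) + (k + 1) * a k) := by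
    have : ∀ k ∈ Finset.range n, ((n : ℝ) - k) * (a k + c) + (k + 1) * a k =
      (n + 1) * a k + ((n : ℝ) - k) * c := fun k _ => by ring
    rw [Finset.sum_congr rfl this, Finset.sum_add_distrib, ← Finset.mul_sum, ← Finset.sum_mul, hc]
    ring
  rw [hs, ha]
  refine Finset.sum_le_sum fun k hk => ?_
  have hk := Finset.mem_range.1 hk
  have hkn : (0 : ℝ) ≤ (n : ℝ) - k := sub_nonneg.2 (by exact_mod_cast hk.le)
  gcongr
  · exact h1 k hk
  · exact h2 k hk

/-- A discrete form of Ruzsa's inequality for sets of integers whose second summand has prime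
diameter. -/
lemma Finset.ruzsa_inequality_int {p : ℕ} (hp : p.Prime) {A B : Finset ℤ} (hA : A.Nonempty)
    (hB : B ⊆ Finset.Icc 0 (p : ℤ)) (h0 : 0 ∈ B) (hpB : (p : ℤ) ∈ B) :
    A.card + p ≤ (A + B).card ∨ ∃ n : ℕ, 1 ≤ n ∧
      ((n : ℝ) + 1) * (A.card / n + ((B.card : ℝ) - 2) / 2) ≤ (A + B).card := by
  have : Fact p.Prime := ⟨hp⟩
  have : NeZero p := ⟨hp.ne_zero⟩
  set n := Finset.univ.sup (residueCount p A) with hn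
  have hle : ∀ x, residueCount p A x ≤ n := fun x => Finset.le_sup (Finset.mem_univ x)
  have hAcard : ∑ k ∈ Finset.range n, (richResidues p A k).card = A.card := by
    rw [sum_card_richResidues, card_eq_sum_residueCount (p := p)]
    exact Finset.sum_congr rfl fun x _ => min_eq_right (hle x)
  have hScard := sum_card_richResidues_le (p := p) (A + B) (n + 1)
  have hn1 : 1 ≤ n := by
    by_contra h
    have : n = 0 := by omega
    rw [this, Finset.sum_range_zero] at hAcard
    exact hA.card_pos.ne hAcard
  have hshift : ∀ k, (richResidues p A k).card ≤ (richResidues p (A + B) (k + 1)).card :=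
    fun k => Finset.card_le_card (richResidues_subset_succ_add h0 hpB k)
  by_cases hfull : p ≤ (richResidues p (A + B) 0).card
  · left
    rw [Finset.sum_range_succ] at hScard
    have h := Finset.sum_le_sum fun k (_ : k ∈ Finset.range n) => hshift k
    rw [← Finset.sum_range_succ, Finset.sum_range_succ'] at hScard
    omega
  right
  refine ⟨n, hn1, ?_⟩
  obtain ⟨x₀, -, hx₀⟩ := Finset.exists_mem_eq_sup Finset.univ
    ⟨(0 : ZMod p), Finset.mem_univ _⟩ (residueCount p A)
  have hBne : (B.image (Int.cast : ℤ → ZMod p)).Nonempty := Finset.Nonempty.image ⟨0, h0⟩ _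
  have hBcard := card_le_card_image_cast_add_one hB
  have hadd : ∀ k < n, (richResidues p A k).card + B.card ≤
      (richResidues p (A + B) k).card + 2 := by
    intro k hk
    have hne : (richResidues p A k).Nonempty :=
      ⟨x₀, mem_richResidues.2 (by rw [← hx₀]; exact hk)⟩
    have h1 := ZMod.cauchy_davenport hp hne hBne
    have h2 := Finset.card_le_card (richResidues_add_subset (p := p) A B k)
    have h3 := Finset.card_le_card (richResidues_antitone (p := p) (A + B) (Nat.zero_le k))
    rcases min_le_iff.1 h1 with h | h <;> omega
  have key := weighted_layer_sum_le (n := n) (a := fun k => ((richResidues p A k).card : ℝ))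
    (s := fun k => ((richResidues p (A + B) k).card : ℝ)) (c := (B.card : ℝ) - 2)
    (fun k hk => by
      have : ((richResidues p A k).card : ℝ) + B.card ≤
        (richResidues p (A + B) k).card + 2 := by exact_mod_cast hadd k hk
      linarith)
    (fun k _ => by exact_mod_cast hshift k)
  have hAcard' : ∑ k ∈ Finset.range n, ((richResidues p A k).card : ℝ) = A.card := by
    exact_mod_cast hAcard
  have hScard' : ∑ k ∈ Finset.range (n + 1), ((richResidues p (A + B) k).card : ℝ) ≤
      (A + B).card := by
    exact_mod_cast hScard
  have hnpos : (0 : ℝ) < n := by exact_mod_cast hn1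
  rw [hAcard'] at key
  refine le_of_mul_le_mul_left ?_ hnpos
  calc (n : ℝ) * (((n : ℝ) + 1) * (A.card / n + ((B.card : ℝ) - 2) / 2))
      = ((n : ℝ) + 1) * A.card + n * (n + 1) / 2 * ((B.card : ℝ) - 2) := by field_simp
    _ ≤ _ := key.trans (by gcongr)

/-- The bound in Ruzsa's inequality, as a function of the number of layers, is smallest at the
index singled out by the ratio `a / b`. -/
lemma ruzsa_bound_le {a b : ℝ} (hb : 0 < b) {K n : ℕ} (hK : 1 ≤ K) (hn : 1 ≤ n)
    (hK1 : (K : ℝ) * ((K : ℝ) - 1) / 2 ≤ a / b) (hK2 : a / b < (K : ℝ) * ((K : ℝ) + 1) / 2) :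
    ((K : ℝ) + 1) * (a / K + b / 2) ≤ ((n : ℝ) + 1) * (a / n + b / 2) := by
  rw [le_div_iff₀ hb] at hK1
  rw [div_lt_iff₀ hb] at hK2
  have hKpos : (0 : ℝ) < K := by exact_mod_cast hK
  have hnpos : (0 : ℝ) < n := by exact_mod_cast hn
  have hdiff : ((n : ℝ) + 1) * (a / n + b / 2) - ((K : ℝ) + 1) * (a / K + b / 2) =
      ((n : ℝ) - K) * (K * n * b / 2 - a) / (K * n) := by
    field_simp
    ring
  rw [← sub_nonneg, hdiff]
  refine div_nonneg ?_ (by positivity)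
  rcases lt_trichotomy n K with h | rfl | h
  · have h' : (n : ℝ) + 1 ≤ K := by exact_mod_cast h
    refine mul_nonneg_of_nonpos_of_nonpos (by linarith) ?_
    nlinarith [mul_nonneg (mul_nonneg hKpos.le hb.le) (sub_nonneg.2 h')]
  · simp
  · have h' : (K : ℝ) + 1 ≤ n := by exact_mod_cast h
    refine mul_nonneg (by linarith) ?_
    nlinarith [mul_nonneg (mul_nonneg hKpos.le hb.le) (sub_nonneg.2 h')]

lemma volume_floor_preimage (c : ℝ) {h : ℝ} (hh : 0 < h) (F : Finset ℤ) :
    volume {z : ℝ | ⌊(z - c) / h⌋ ∈ F} = ENNReal.ofReal (F.card * h) := by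
  have hfloor (z : ℝ) (i : ℤ) :
      ⌊(z - c) / h⌋ = i ↔ z ∈ Ico (c + i * h) (c + (i + 1) * h) := by
    rw [Int.floor_eq_iff, le_div_iff₀ hh, div_lt_iff₀ hh, mem_Ico, le_sub_iff_add_le',
      sub_lt_iff_lt_add']
  have hset : {z : ℝ | ⌊(z - c) / h⌋ ∈ F} =
      ⋃ i ∈ F, Ico (c + i * h) (c + (i + 1) * h) := by
    ext z
    simp only [mem_ofPred_eq, mem_iUnion, ← hfloor, exists_prop, exists_eq_right']
  rw [hset, measure_biUnion_finset]
  · have : ∀ i : ℤ, c + ((i : ℝ) + 1) * h - (c + i * h) = h := fun i => by ring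
    simp only [Real.volume_Ico, this, Finset.sum_const, nsmul_eq_mul]
    rw [ENNReal.ofReal_mul (by positivity), ENNReal.ofReal_natCast]
  · intro i _ j _ hij
    rw [Function.onFun, Set.disjoint_left]
    intro z hi hj
    exact hij (((hfloor z i).2 hi).symm.trans ((hfloor z j).2 hj))
  · exact fun i _ => measurableSet_Ico

lemma IsCompact.finite_image_floor {A : Set ℝ} (hA : IsCompact A) (c : ℝ) {h : ℝ} (hh : 0 < h) :
    ((fun z => ⌊(z - c) / h⌋) '' A).Finite := by
  obtain ⟨u, hu⟩ := hA.bddAbove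
  obtain ⟨l, hl⟩ := hA.bddBelow
  refine (Set.finite_Icc ⌊(l - c) / h⌋ ⌊(u - c) / h⌋).subset ?_
  rintro _ ⟨z, hz, rfl⟩
  have h1 := hl hz
  have h2 := hu hz
  constructor <;> dsimp only <;> gcongr

lemma volume_toReal_le_card_mul {A : Set ℝ} {c h : ℝ} (hh : 0 < h) {F : Finset ℤ}
    (hF : ∀ z ∈ A, ⌊(z - c) / h⌋ ∈ F) : (volume A).toReal ≤ F.card * h := by
  refine ENNReal.toReal_le_of_le_ofReal (by positivity) ?_
  rw [← volume_floor_preimage c hh]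
  exact measure_mono hF

/-- Ruzsa's inequality at scale `diam B / p`, with `A + B` replaced by a thickening. -/
lemma ruzsa_inequality_cthickening {A B : Set ℝ} (hA : IsCompact A) (hB : IsCompact B)
    (hAne : A.Nonempty) (hBne : B.Nonempty) (hD : 0 < sSup B - sInf B) {p : ℕ} (hp : p.Prime) :
    (volume A).toReal + (sSup B - sInf B) ≤
        (volume (Metric.cthickening (2 * ((sSup B - sInf B) / p)) (A + B))).toReal ∨
      ∃ n : ℕ, 1 ≤ n ∧ ((n : ℝ) + 1) * ((volume A).toReal / n +
          ((volume B).toReal - 2 * ((sSup B - sInf B) / p)) / 2) ≤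
        (volume (Metric.cthickening (2 * ((sSup B - sInf B) / p)) (A + B))).toReal := by
  have hp0 : (0 : ℝ) < p := by exact_mod_cast hp.pos
  set D := sSup B - sInf B with hDdef
  set c := sInf B with hc
  set h := D / p with hhdef
  have hh : 0 < h := div_pos hD hp0
  have hph : (p : ℝ) * h = D := by rw [hhdef]; field_simp
  set F := (hA.finite_image_floor 0 hh).toFinset with hF
  set G := (hB.finite_image_floor c hh).toFinset with hG
  have hFmem : ∀ z ∈ A, ⌊(z - 0) / h⌋ ∈ F := fun z hz => by
    rw [hF, Set.Finite.mem_toFinset]; exact ⟨z, hz, rfl⟩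
  have hGmem : ∀ z ∈ B, ⌊(z - c) / h⌋ ∈ G := fun z hz => by
    rw [hG, Set.Finite.mem_toFinset]; exact ⟨z, hz, rfl⟩
  have hFne : F.Nonempty := hAne.elim fun z hz => ⟨_, hFmem z hz⟩
  have hG0 : 0 ∈ G := by simpa using hGmem c (hB.sInf_mem hBne)
  have hDh : D / h = p := by rw [← hph]; field_simp
  have hGp : (p : ℤ) ∈ G := by
    have := hGmem (sSup B) (hB.sSup_mem hBne)
    rwa [← hDdef, hDh, Int.floor_natCast] at this
  have hGsub : G ⊆ Finset.Icc 0 (p : ℤ) := by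
    intro i hi
    rw [hG, Set.Finite.mem_toFinset] at hi
    obtain ⟨z, hz, rfl⟩ := hi
    have h1 : c ≤ z := csInf_le hB.bddBelow hz
    have h2 : z ≤ sSup B := le_csSup hB.bddAbove hz
    rw [Finset.mem_Icc]
    refine ⟨Int.floor_nonneg.2 (div_nonneg (by linarith) hh.le), ?_⟩
    rw [← Int.floor_natCast (R := ℝ) p, ← hDh]
    dsimp only
    gcongr
    linarith
  have hvA := volume_toReal_le_card_mul hh hFmem
  have hvB := volume_toReal_le_card_mul hh hGmem
  have hvS : ((F + G).card : ℝ) * h ≤ (volume (Metric.cthickening (2 * h) (A + B))).toReal := by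
    rw [← ENNReal.ofReal_le_iff_le_toReal
      ((hA.add hB).isBounded.cthickening.measure_lt_top.ne), ← volume_floor_preimage c hh]
    refine measure_mono fun z hz => ?_
    obtain ⟨i, hi, j, hj, hij⟩ := Finset.mem_add.1 hz
    rw [hF, Set.Finite.mem_toFinset] at hi
    rw [hG, Set.Finite.mem_toFinset] at hj
    obtain ⟨x, hx, rfl⟩ := hi
    obtain ⟨y, hy, rfl⟩ := hj
    refine Metric.mem_cthickening_of_dist_le z (x + y) _ _ (Set.add_mem_add hx hy) ?_
    have hij := hij.symm
    dsimp only at hij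
    have bounds : ∀ w : ℝ, ⌊w / h⌋ * h ≤ w ∧ w < ⌊w / h⌋ * h + h := fun w => by
      have h1 := Int.floor_le (w / h)
      have h2 := Int.lt_floor_add_one (w / h)
      rw [le_div_iff₀ hh] at h1
      rw [div_lt_iff₀ hh] at h2
      exact ⟨h1, by linarith⟩
    have hz := bounds (z - c)
    rw [hij] at hz
    push_cast at hz
    have hx' := bounds (x - 0)
    have hy' := bounds (y - c)
    rw [Real.dist_eq, abs_le]
    constructor <;> nlinarith
  rcases Finset.ruzsa_inequality_int hp hFne hGsub hG0 hGp with hcase | ⟨n, hn, hcase⟩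
  · left
    have hcase : (F.card : ℝ) + p ≤ (F + G).card := by exact_mod_cast hcase
    have := mul_le_mul_of_nonneg_right hcase hh.le
    linarith
  · right
    refine ⟨n, hn, ?_⟩
    have hn0 : (0 : ℝ) < n := by exact_mod_cast hn
    calc ((n : ℝ) + 1) * ((volume A).toReal / n + ((volume B).toReal - 2 * h) / 2)
        ≤ ((n : ℝ) + 1) * (F.card * h / n + (G.card * h - 2 * h) / 2) := by gcongr
      _ = ((n : ℝ) + 1) * (F.card / n + ((G.card : ℝ) - 2) / 2) * h := by ring
      _ ≤ (F + G).card * h := by gcongr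
      _ ≤ _ := hvS

/-- Theorem 1.2 (Ruzsa): for compact sets `A`, `B` of positive measure, with `K` the unique
positive integer such that `K(K-1)/2 ≤ λ(A)/λ(B) < K(K+1)/2`, either
`λ(A+B) ≥ λ(A) + diam(B)` or `λ(A+B) ≥ (K+1)(λ(A)/K + λ(B)/2)`. -/
theorem ruzsa_inequality (A B : Set ℝ) (hA : IsCompact A) (hB : IsCompact B)
    (hApos : 0 < volume A) (hBpos : 0 < volume B)
    (K : ℕ) (hK : 1 ≤ K)
    (hK1 : (K : ℝ) * ((K : ℝ) - 1) / 2 ≤ (volume A).toReal / (volume B).toReal)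
    (hK2 : (volume A).toReal / (volume B).toReal < (K : ℝ) * ((K : ℝ) + 1) / 2) :
    (volume (A + B)).toReal ≥ (volume A).toReal + (sSup B - sInf B) ∨
      (volume (A + B)).toReal ≥
        ((K : ℝ) + 1) * ((volume A).toReal / (K : ℝ) + (volume B).toReal / 2) := by
  have hAne : A.Nonempty := nonempty_of_measure_ne_zero hApos.ne'
  have hBne : B.Nonempty := nonempty_of_measure_ne_zero hBpos.ne'
  have hb : 0 < (volume B).toReal := ENNReal.toReal_pos hBpos.ne' hB.measure_lt_top.ne
  have hD : 0 < sSup B - sInf B := by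
    have hsub : B ⊆ Icc (sInf B) (sSup B) := fun z hz =>
      ⟨csInf_le hB.bddBelow hz, le_csSup hB.bddAbove hz⟩
    have := hBpos.trans_le (measure_mono hsub)
    rwa [Real.volume_Icc, ENNReal.ofReal_pos] at this
  have hbound : ∀ m : ℕ, min ((volume A).toReal + (sSup B - sInf B))
      ((1 - 2 * ((sSup B - sInf B) / (Nat.nth Nat.Prime m : ℕ)) / (volume B).toReal) *
        (((K : ℝ) + 1) * ((volume A).toReal / K + (volume B).toReal / 2))) ≤
      (volume (Metric.cthickening (2 * ((sSup B - sInf B) / (Nat.nth Nat.Prime m : ℕ)))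
        (A + B))).toReal := by
    intro m
    have hp : (Nat.nth Nat.Prime m).Prime := Nat.prime_nth_prime m
    generalize Nat.nth Nat.Prime m = p at hp ⊢
    rcases ruzsa_inequality_cthickening hA hB hAne hBne hD hp with h | ⟨n, hn, h⟩
    · exact min_le_of_left_le h
    · refine min_le_of_right_le ?_
      set e := 2 * ((sSup B - sInf B) / p) with he
      have he0 : 0 ≤ e := by positivity
      have hmin := ruzsa_bound_le hb hK hn hK1 hK2
      have hKb : 0 ≤ ((K : ℝ) + 1) * ((volume A).toReal / K + (volume B).toReal / 2) := by
        positivity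
      by_cases he1 : 0 ≤ 1 - e / (volume B).toReal
      · refine (mul_le_mul_of_nonneg_left hmin he1).trans (le_trans ?_ h)
        have hA0 : 0 ≤ ((n : ℝ) + 1) * ((volume A).toReal / n) * (e / (volume B).toReal) := by
          positivity
        have heq : e / (volume B).toReal * (volume B).toReal = e := by field_simp
        nlinarith
      · exact (mul_nonpos_of_nonpos_of_nonneg (not_le.1 he1).le hKb).trans ENNReal.toReal_nonneg
  have hscale : Filter.Tendsto
      (fun m : ℕ => 2 * ((sSup B - sInf B) / ((Nat.nth Nat.Prime m : ℕ) : ℝ)))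
      Filter.atTop (nhds 0) := by
    have h1 : Filter.Tendsto (fun m : ℕ => ((Nat.nth Nat.Prime m : ℕ) : ℝ))
        Filter.atTop Filter.atTop :=
      tendsto_natCast_atTop_atTop.comp
        (Nat.nth_strictMono Nat.infinite_setOfPred_prime).tendsto_atTop
    simpa using (h1.const_div_atTop (sSup B - sInf B)).const_mul 2
  have hright := (ENNReal.tendsto_toReal (hA.add hB).measure_lt_top.ne).comp
    ((tendsto_measure_cthickening_of_isCompact (μ := volume) (hA.add hB)).comp hscale)
  have hleft := (tendsto_const_nhds (x := (volume A).toReal + (sSup B - sInf B))).min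
    (((hscale.div_const (volume B).toReal).const_sub 1).mul_const
      (((K : ℝ) + 1) * ((volume A).toReal / K + (volume B).toReal / 2)))
  have hlim := le_of_tendsto_of_tendsto' hleft hright hbound
  rw [zero_div, sub_zero, one_mul] at hlim
  exact min_le_iff.1 hlim
end

section
/- Let A be a finite subset of ℤ with at least 2 elements, and define N_A = (max(A) − min(A))/gcd*(A), where gcd*(A) is the greatest common divisor of the elements of A − min(A). Then |A + A| ≥ min(3|A| − 3, |A| + N_A). -/
open Pointwise

/-- A discrete intermediate value theorem, locating the first time a level is reached. -/
lemma exists_first_eq {f : ℤ → ℤ} (hf : ∀ x, f (x + 1) ≤ f x + 1) {a b v : ℤ} (hab : a ≤ b)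
    (ha : f a < v) (hb : v ≤ f b) :
    ∃ t, a < t ∧ t ≤ b ∧ f t = v ∧ ∀ y, a ≤ y → y < t → f y < v := by
  obtain ⟨t, ⟨h1, h2⟩, h3⟩ := Int.exists_least_of_bdd (P := fun y => a ≤ y ∧ v ≤ f y)
    ⟨a, fun z hz => hz.1⟩ ⟨b, hab, hb⟩
  have hta : t ≠ a := by rintro rfl; omega
  have hlt : ∀ y, a ≤ y → y < t → f y < v := fun y h4 h5 => by
    by_contra h
    have := h3 y ⟨h4, by omega⟩
    omega
  have h4 := hlt (t - 1) (by omega) (by omega)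
  have h5 := hf (t - 1)
  rw [sub_add_cancel] at h5
  exact ⟨t, by omega, h3 b ⟨hab, hb⟩, by omega, hlt⟩

/-- A discrete intermediate value theorem, locating the last time a level is reached. -/
lemma exists_last_eq {f : ℤ → ℤ} (hf : ∀ x, f (x + 1) ≤ f x + 1) {a b v : ℤ} (hab : a ≤ b)
    (ha : f a ≤ v) (hb : v < f b) :
    ∃ t, a ≤ t ∧ t < b ∧ f t = v ∧ ∀ y, t < y → y ≤ b → v < f y := by
  obtain ⟨t, h1, h2, h3, h4⟩ := exists_first_eq (f := fun y => -f (-y)) (a := -b) (b := -a)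
    (v := -v) (fun x => by
      have := hf (-(x + 1))
      rw [show -(x + 1) + 1 = -x by ring] at this
      omega) (by omega) (by simpa using hb) (by simpa using ha)
  refine ⟨-t, by omega, by omega, by simpa using h3, fun y h5 h6 => ?_⟩
  simpa using h4 (-y) (by omega) (by omega)

namespace Finset

/-- The signed discrepancy between the length of `[0, x)` and twice the number of elements
of `A` below `x`. -/
def excess (A : Finset ℤ) (x : ℤ) : ℤ := x - 2 * ((A.filter (· < x)).card : ℤ)

lemma excess_succ_of_mem {A : Finset ℤ} {x : ℤ} (hx : x ∈ A) :
    A.excess (x + 1) = A.excess x - 1 := by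
  have h : A.filter (· < x + 1) = insert x (A.filter (· < x)) := by
    ext y
    simp only [mem_filter, mem_insert]
    grind
  rw [excess, excess, h, card_insert_of_notMem (by simp)]
  push_cast
  ring

lemma excess_succ_of_notMem {A : Finset ℤ} {x : ℤ} (hx : x ∉ A) :
    A.excess (x + 1) = A.excess x + 1 := by
  have h : A.filter (· < x + 1) = A.filter (· < x) := by
    ext y
    simp only [mem_filter]
    grind
  rw [excess, excess, h]
  ring

lemma excess_succ_le (A : Finset ℤ) (x : ℤ) : A.excess (x + 1) ≤ A.excess x + 1 := by
  by_cases hx : x ∈ A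
  · rw [excess_succ_of_mem hx]; omega
  · rw [excess_succ_of_notMem hx]

lemma le_excess_succ (A : Finset ℤ) (x : ℤ) : A.excess x - 1 ≤ A.excess (x + 1) := by
  by_cases hx : x ∈ A
  · rw [excess_succ_of_mem hx]
  · rw [excess_succ_of_notMem hx]; omega

/-- Pigeonhole: a set filling more than half of an interval represents the sum of the ends. -/
lemma add_mem_add_of_card_lt {A B : Finset ℤ} {a b : ℤ} (hBA : B ⊆ A) (hB : B ⊆ Icc a b)
    (hab : a ≤ b) (h : b - a + 1 < 2 * (B.card : ℤ)) : a + b ∈ A + A := by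
  by_contra hn
  have hd : Disjoint B (B.image (a + b - ·)) := by
    rw [disjoint_left]
    intro x hx hx'
    obtain ⟨y, hy, rfl⟩ := mem_image.1 hx'
    exact hn (mem_add.2 ⟨_, hBA hx, y, hBA hy, by ring⟩)
  have hsub : B ∪ B.image (a + b - ·) ⊆ Icc a b := by
    refine union_subset hB fun x hx => ?_
    obtain ⟨y, hy, rfl⟩ := mem_image.1 hx
    have := mem_Icc.1 (hB hy)
    rw [mem_Icc]
    omega
  have hc := card_le_card hsub
  rw [card_union_of_disjoint hd, card_image_of_injective _ sub_right_injective, Int.card_Icc] at hc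
  omega

lemma mem_add_self_of_excess_neg {A : Finset ℤ} (hA : ∀ a ∈ A, 0 ≤ a) {n : ℤ} (hn : 0 ≤ n)
    (h : A.excess (n + 1) < 0) : n ∈ A + A := by
  have := add_mem_add_of_card_lt (B := A.filter (· < n + 1)) (a := 0) (b := n)
    (filter_subset _ _) (fun x hx => by
      rw [mem_filter] at hx
      rw [mem_Icc]
      have := hA x hx.1
      omega) hn (by unfold excess at h; omega)
  simpa using this

lemma card_filter_lt_add_card_filter_ge (A : Finset ℤ) (x : ℤ) :
    (A.filter (· < x)).card + (A.filter (x ≤ ·)).card = A.card := by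
  rw [← card_filter_add_card_filter_not (s := A) (· < x)]
  simp only [not_lt]

lemma mem_add_self_of_lt_excess {A : Finset ℤ} {N : ℤ} (hA : ∀ a ∈ A, a ≤ N) {y : ℤ} (hy : y ≤ N)
    (h : N + 1 - 2 * (A.card : ℤ) < A.excess y) : y + N ∈ A + A := by
  refine add_mem_add_of_card_lt (B := A.filter (y ≤ ·)) (filter_subset _ _) (fun x hx => by
      rw [mem_filter] at hx
      rw [mem_Icc]
      have := hA x hx.1
      omega) hy ?_
  have := A.card_filter_lt_add_card_filter_ge y
  unfold excess at h
  omega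

lemma card_add_card_le_card_add_add_one {A B : Finset ℤ} (hA : A.Nonempty) (hB : B.Nonempty) :
    A.card + B.card ≤ (A + B).card + 1 := by
  have := cauchy_davenport_add_of_linearOrder_isCancelAdd hA hB
  omega

/-- `A` has minimum `m`, maximum `M`, and its differences generate `ℤ`. -/
structure IsPrimitiveOn (A : Finset ℤ) (m M : ℤ) : Prop where
  left_mem : m ∈ A
  right_mem : M ∈ A
  left_le : ∀ a ∈ A, m ≤ a
  le_right : ∀ a ∈ A, a ≤ M
  isUnit_of_dvd : ∀ d : ℤ, (∀ a ∈ A, d ∣ a - m) → IsUnit d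

lemma isPrimitiveOn_of_mem_of_succ_mem {A : Finset ℤ} {m M x : ℤ} (hm : m ∈ A) (hM : M ∈ A)
    (h1 : ∀ a ∈ A, m ≤ a) (h2 : ∀ a ∈ A, a ≤ M) (hx : x ∈ A) (hx' : x + 1 ∈ A) :
    A.IsPrimitiveOn m M where
  left_mem := hm
  right_mem := hM
  left_le := h1
  le_right := h2
  isUnit_of_dvd d hd := by
    have := dvd_sub (hd _ hx') (hd _ hx)
    rw [show x + 1 - m - (x - m) = 1 by ring] at this
    exact isUnit_of_dvd_one this

/-- The sparse case of Freiman's theorem holds for all sets smaller than `k`. -/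
def FreimanBelow (k : ℕ) : Prop :=
  ∀ B : Finset ℤ, B.card < k → ∀ m M : ℤ, B.IsPrimitiveOn m M →
    2 * (B.card : ℤ) ≤ M - m + 3 → 3 * B.card ≤ (B + B).card + 3

/-- A set filling more than half of `[0, N]` has a large sumset. -/
lemma card_add_le_card_add_self_of_dense {A : Finset ℤ} {N : ℤ} (h0 : 0 ∈ A) (hN : N ∈ A)
    (hA : ∀ a ∈ A, 0 ≤ a) (hA' : ∀ a ∈ A, a ≤ N) (h : N + 3 ≤ 2 * (A.card : ℤ)) :
    (A.card : ℤ) + N ≤ (A + A).card := by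
  have key : ∀ n, 0 ≤ n → n < N → n ∈ A + A ∨ n + N ∈ A + A := by
    intro n h1 h2
    by_cases h : A.excess (n + 1) < 0
    · exact .inl (mem_add_self_of_excess_neg hA h1 h)
    · refine .inr (mem_add_self_of_lt_excess hA' h2.le ?_)
      have := A.excess_succ_le n
      omega
  have hdisj : Disjoint ((Ico 0 N).image fun n => if n ∈ A + A then n else n + N)
      (A.image (N + ·)) := by
    rw [disjoint_left]
    intro x hx hx'
    obtain ⟨a, ha, rfl⟩ := mem_image.1 hx'
    obtain ⟨n, hn, hna⟩ := mem_image.1 hx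
    have := hA a ha
    rw [mem_Ico] at hn
    split_ifs at hna with hmem
    · omega
    · obtain rfl : n = a := by omega
      exact hmem (mem_add.2 ⟨0, h0, n, ha, by ring⟩)
  have hsub : ((Ico 0 N).image fun n => if n ∈ A + A then n else n + N) ∪ A.image (N + ·)
      ⊆ A + A := by
    refine union_subset (fun x hx => ?_) (fun x hx => ?_)
    · obtain ⟨n, hn, rfl⟩ := mem_image.1 hx
      rw [mem_Ico] at hn
      split_ifs with hmem
      · exact hmem
      · exact (key n hn.1 hn.2).resolve_left hmem
    · obtain ⟨a, ha, rfl⟩ := mem_image.1 hx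
      exact add_mem_add hN ha
  have hc := card_le_card hsub
  rw [card_union_of_disjoint hdisj, card_image_of_injective _ (add_right_injective N),
    card_image_of_injOn, Int.card_Ico] at hc
  · have := hA N hN
    omega
  · intro x hx y hy hxy
    simp only [coe_Ico, Set.mem_Ico] at hx hy
    dsimp only at hxy
    split_ifs at hxy <;> omega

/-- The case of a gap separating a left part that is dense from a right part that is dense. -/
lemma three_mul_card_le_of_two_blocks {A : Finset ℤ} {N T U : ℤ} (h0 : 0 ∈ A) (hN : N ∈ A)
    (hA : ∀ a ∈ A, 0 ≤ a) (hA' : ∀ a ∈ A, a ≤ N) (hT0 : 1 < T) (hUN : U < N)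
    (hT : A.excess T = 0) (hU : A.excess U = N + 1 - 2 * (A.card : ℤ)) (hTU : T ≤ U + 1)
    (hlt : ∀ y, 1 ≤ y → y < T → A.excess y < 0)
    (hgt : ∀ y, U < y → y ≤ N → N + 1 - 2 * (A.card : ℤ) < A.excess y)
    (hgap : ∀ a ∈ A, T - 1 ≤ a → U < a) :
    3 * A.card ≤ (A + A).card + 3 := by
  set L := A.filter (· < T) with hL
  set R := A.filter (T ≤ ·) with hR
  have hLR := A.card_filter_lt_add_card_filter_ge T
  rw [← hL, ← hR] at hLR
  have hUL : A.filter (· < U) = L := by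
    ext y
    simp only [hL, mem_filter]
    refine and_congr_right fun hy => ?_
    have := hgap y hy
    omega
  have hcL : T = 2 * (L.card : ℤ) := by unfold excess at hT; rw [← hL] at hT; omega
  have hcU : U = 2 * (L.card : ℤ) + (N + 1 - 2 * (A.card : ℤ)) := by
    unfold excess at hU
    rw [hUL] at hU
    omega
  have hLmem : ∀ y ∈ L, y ∈ A ∧ y < T - 1 := fun y hy => by
    rw [hL, mem_filter] at hy
    have := hgap y hy.1
    exact ⟨hy.1, by omega⟩
  have hRmem : ∀ y ∈ R, y ∈ A ∧ U < y := fun y hy => by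
    rw [hR, mem_filter] at hy
    exact ⟨hy.1, hgap y hy.1 (by omega)⟩
  have hLne : L.Nonempty := ⟨0, by rw [hL, mem_filter]; exact ⟨h0, by omega⟩⟩
  have hRne : R.Nonempty := ⟨N, by rw [hR, mem_filter]; exact ⟨hN, by omega⟩⟩
  have hmid := card_add_card_le_card_add_add_one hLne hRne
  have hsub : (Icc 0 (T - 2) ∪ (L + R)) ∪ Ioc (U + N) (N + N) ⊆ A + A := by
    refine union_subset (union_subset (fun x hx => ?_) (fun x hx => ?_)) (fun x hx => ?_)
    · rw [mem_Icc] at hx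
      exact mem_add_self_of_excess_neg hA hx.1 (hlt _ (by omega) (by omega))
    · exact add_subset_add (filter_subset _ _) (filter_subset _ _) hx
    · rw [mem_Ioc] at hx
      have := mem_add_self_of_lt_excess hA' (y := x - N) (by omega) (hgt _ (by omega) (by omega))
      simpa using this
  have hd1 : Disjoint (Icc 0 (T - 2)) (L + R) := by
    rw [disjoint_left]
    intro x hx hx'
    obtain ⟨u, hu, v, hv, rfl⟩ := mem_add.1 hx'
    rw [mem_Icc] at hx
    have := hA u (hLmem u hu).1
    have := (hRmem v hv).2
    omega
  have hd2 : Disjoint (Icc 0 (T - 2) ∪ (L + R)) (Ioc (U + N) (N + N)) := by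
    rw [disjoint_left]
    intro x hx hx'
    rw [mem_Ioc] at hx'
    rcases mem_union.1 hx with hx | hx
    · rw [mem_Icc] at hx
      have := hA N hN
      omega
    · obtain ⟨u, hu, v, hv, rfl⟩ := mem_add.1 hx
      have := (hLmem u hu).2
      have := hA' v (hRmem v hv).1
      omega
  have hc := card_le_card hsub
  rw [card_union_of_disjoint hd2, card_union_of_disjoint hd1, Int.card_Icc, Int.card_Ioc] at hc
  omega

/-- The case of two consecutive elements at which `A` may be cut. -/
lemma three_mul_card_le_of_consecutive {A : Finset ℤ} {N x : ℤ} (ih : FreimanBelow A.card)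
    (h0 : 0 ∈ A) (hN : N ∈ A) (hA : ∀ a ∈ A, 0 ≤ a) (hA' : ∀ a ∈ A, a ≤ N)
    (hx : x ∈ A) (hx' : x + 1 ∈ A) (hx0 : 0 < x) (hxN : x + 1 < N)
    (h1 : 0 ≤ A.excess x) (h2 : A.excess x ≤ N + 3 - 2 * (A.card : ℤ)) :
    3 * A.card ≤ (A + A).card + 3 := by
  set B := A.filter (· < x + 1 + 1) with hB
  set C := A.filter (x ≤ ·) with hC
  have hBC := A.card_filter_lt_add_card_filter_ge x
  rw [← hC] at hBC
  have e1 := excess_succ_of_mem hx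
  have e2 := excess_succ_of_mem hx'
  have hcB : (B.card : ℤ) = (A.filter (· < x)).card + 2 := by
    unfold excess at e1 e2
    rw [← hB] at e2
    omega
  have hBA : B ⊆ A := filter_subset _ _
  have hCA : C ⊆ A := filter_subset _ _
  have hBlt : B.card < A.card := card_lt_card (ssubset_iff_of_subset hBA |>.2
    ⟨N, hN, by rw [hB, mem_filter]; omega⟩)
  have hClt : C.card < A.card := card_lt_card (ssubset_iff_of_subset hCA |>.2
    ⟨0, h0, by rw [hC, mem_filter]; omega⟩)
  have hmB : ∀ {y}, y ∈ A → y ≤ x + 1 → y ∈ B := fun hy h => by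
    rw [hB, mem_filter]; exact ⟨hy, by omega⟩
  have hmC : ∀ {y}, y ∈ A → x ≤ y → y ∈ C := fun hy h => by
    rw [hC, mem_filter]; exact ⟨hy, by omega⟩
  have hBle : ∀ y ∈ B, y ≤ x + 1 := fun y hy => by
    have := (mem_filter.1 hy).2
    omega
  have hCge : ∀ y ∈ C, x ≤ y := fun y hy => (mem_filter.1 hy).2
  have iB := ih B hBlt 0 (x + 1) (isPrimitiveOn_of_mem_of_succ_mem (hmB h0 (by omega))
    (hmB hx' le_rfl) (fun a ha => hA a (hBA ha)) hBle (hmB hx (by omega)) (hmB hx' le_rfl))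
    (by unfold excess at h1; omega)
  have iC := ih C hClt x N (isPrimitiveOn_of_mem_of_succ_mem (hmC hx le_rfl)
    (hmC hN (by omega)) hCge (fun a ha => hA' a (hCA ha)) (hmC hx le_rfl) (hmC hx' (by omega)))
    (by unfold excess at h2; omega)
  have hinter : (B + B) ∩ (C + C) ⊆ Icc (x + x) (x + x + 2) := by
    intro z hz
    obtain ⟨hz1, hz2⟩ := mem_inter.1 hz
    obtain ⟨a, ha, b, hb, rfl⟩ := mem_add.1 hz1
    obtain ⟨c, hc, d, hd, hcd⟩ := mem_add.1 hz2
    have := hBle a ha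
    have := hBle b hb
    have := hCge c hc
    have := hCge d hd
    rw [mem_Icc]
    omega
  have hi := card_le_card hinter
  rw [Int.card_Icc] at hi
  have hu := card_le_card (union_subset (add_subset_add hBA hBA) (add_subset_add hCA hCA))
  have := card_union_add_card_inter (B + B) (C + C)
  omega

/-- Cutting at an element above a dense block, when the upper part lies in a proper
arithmetic progression. -/
lemma three_mul_card_le_of_dvd_upper {A : Finset ℤ} {N T m d : ℤ} (hP : A.IsPrimitiveOn 0 N)
    (hlow : Icc 0 (T - 2) ⊆ A + A) (hT : T = 2 * ((A.filter (· < m)).card : ℤ)) (hTm : T ≤ m)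
    (hm : m ∈ A) (hd : ¬ IsUnit d) (hdvd : ∀ a ∈ A, m ≤ a → d ∣ a - m) :
    3 * A.card ≤ (A + A).card + 3 := by
  set L := A.filter (· < m) with hL
  set C := A.filter (m ≤ ·) with hC
  have hLC := A.card_filter_lt_add_card_filter_ge m
  rw [← hL, ← hC] at hLC
  have hLA : L ⊆ A := filter_subset _ _
  have hCA : C ⊆ A := filter_subset _ _
  have hLlt : ∀ y ∈ L, y < m := fun y hy => (mem_filter.1 hy).2
  have hCge : ∀ y ∈ C, m ≤ y := fun y hy => (mem_filter.1 hy).2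
  have hmC : m ∈ C := by rw [hC, mem_filter]; exact ⟨hm, le_rfl⟩
  set L₀ := L.filter (d ∣ · - m) with hL₀
  set L₁ := L.filter (¬ d ∣ · - m) with hL₁
  have hL01 : L₀.card + L₁.card = L.card := card_filter_add_card_filter_not _
  have hL₁ne : L₁.Nonempty := by
    by_contra hne
    rw [not_nonempty_iff_eq_empty, hL₁, filter_eq_empty_iff] at hne
    have hall : ∀ a ∈ A, d ∣ a - m := fun a ha => by
      by_cases h : a < m
      · exact not_not.1 (hne (mem_filter.2 ⟨ha, h⟩))
      · exact hdvd a ha (by omega)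
    refine hd (hP.isUnit_of_dvd d fun a ha => ?_)
    have := dvd_sub (hall a ha) (hall 0 hP.left_mem)
    rwa [sub_sub_sub_cancel_right] at this
  have hCC := card_add_card_le_card_add_add_one ⟨m, hmC⟩ ⟨m, hmC⟩
  have hLC' := card_add_card_le_card_add_add_one hL₁ne ⟨m, hmC⟩
  have hsub : ((Icc 0 (T - 2) ∪ L₀.image (m + ·)) ∪ (C + C)) ∪ (L₁ + C) ⊆ A + A := by
    refine union_subset (union_subset (union_subset hlow fun x hx => ?_)
      (add_subset_add hCA hCA)) (add_subset_add ((filter_subset _ _).trans hLA) hCA)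
    obtain ⟨a, ha, rfl⟩ := mem_image.1 hx
    exact add_mem_add hm (hLA (filter_subset _ _ ha))
  have hd1 : Disjoint (Icc 0 (T - 2)) (L₀.image (m + ·)) := by
    rw [disjoint_left]
    intro x hx hx'
    obtain ⟨a, ha, rfl⟩ := mem_image.1 hx'
    have := hP.left_le a (hLA (filter_subset _ _ ha))
    rw [mem_Icc] at hx
    omega
  have hd2 : Disjoint (Icc 0 (T - 2) ∪ L₀.image (m + ·)) (C + C) := by
    rw [disjoint_left]
    intro x hx hx'
    obtain ⟨u, hu, v, hv, rfl⟩ := mem_add.1 hx'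
    have := hCge u hu
    have := hCge v hv
    have := hP.left_le m hm
    rcases mem_union.1 hx with hx | hx
    · rw [mem_Icc] at hx
      omega
    · obtain ⟨a, ha, hau⟩ := mem_image.1 hx
      have := hLlt a (filter_subset _ _ ha)
      omega
  have hd3 : Disjoint ((Icc 0 (T - 2) ∪ L₀.image (m + ·)) ∪ (C + C)) (L₁ + C) := by
    rw [disjoint_left]
    intro x hx hx'
    obtain ⟨u, hu, v, hv, rfl⟩ := mem_add.1 hx'
    rw [hL₁, mem_filter] at hu
    have hvm := hdvd v (hCA hv) (hCge v hv)
    rcases mem_union.1 hx with hx | hx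
    · rcases mem_union.1 hx with hx | hx
      · have := hCge v hv
        have := hP.left_le u (hLA hu.1)
        rw [mem_Icc] at hx
        omega
      · obtain ⟨a, ha, hau⟩ := mem_image.1 hx
        rw [hL₀, mem_filter] at ha
        have := dvd_sub ha.2 hvm
        rw [show a - m - (v - m) = u - m by omega] at this
        exact hu.2 this
    · obtain ⟨a, ha, b, hb, hab⟩ := mem_add.1 hx
      have := dvd_sub (dvd_add (hdvd a (hCA ha) (hCge a ha)) (hdvd b (hCA hb) (hCge b hb))) hvm
      rw [show a - m + (b - m) - (v - m) = u - m by omega] at this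
      exact hu.2 this
  have hc := card_le_card hsub
  rw [card_union_of_disjoint hd3, card_union_of_disjoint hd2, card_union_of_disjoint hd1,
    card_image_of_injective _ (add_right_injective m), Int.card_Icc] at hc
  omega

/-- A sum of an element below `m` with an element above `m` that is neither `m` plus an element
up to `m`, nor a sum of two elements from `m` on. -/
lemma exists_mem_add_self_new {A : Finset ℤ} {N T m : ℤ} (hP : A.IsPrimitiveOn 0 N)
    (hT0 : 1 < T) (hT : T = 2 * ((A.filter (· < m)).card : ℤ)) (hTm : T ≤ m) (hm : m ∈ A)
    (hmN : m < N) (hlt : ∀ a ∈ A, a < m → a < T - 1) (h1 : 1 ∉ A → T = 2) :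
    ∃ z ∈ A + A, m ≤ z ∧ (∀ a ∈ A, a ≤ m → z ≠ m + a) ∧
      ∀ a ∈ A, m ≤ a → ∀ b ∈ A, m ≤ b → z ≠ a + b := by
  by_cases h : 1 ∈ A
  · obtain ⟨m', ⟨hm'A, hmm'⟩, hmin⟩ := Int.exists_least_of_bdd (P := fun y => y ∈ A ∧ m < y)
      ⟨m, fun z hz => hz.2.le⟩ ⟨N, hP.right_mem, hmN⟩
    set L := A.filter (· < m) with hL
    have hmemL : ∀ {y}, y ∈ L ↔ y ∈ A ∧ y < m := by simp [hL]
    by_contra! hcon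
    have hshift : ∀ u ∈ L, u + (m' - m) ∈ insert m L := by
      intro u hu
      rw [hmemL] at hu
      have hu0 := hP.left_le u hu.1
      by_contra hn
      rw [mem_insert, hmemL, not_or] at hn
      obtain ⟨a, ha, hma, b, hb, hmb, hab⟩ := hcon (u + m') (add_mem_add hu.1 hm'A) (by omega)
        (fun a ha ham hum => by
          obtain rfl : a = u + (m' - m) := by omega
          exact hn.2 ⟨ha, by omega⟩)
      have := fun h => hmin a ⟨ha, h⟩
      have := fun h => hmin b ⟨hb, h⟩
      omega
    have h0L : 0 ∈ L := hmemL.2 ⟨hP.left_mem, by omega⟩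
    have h1L : 1 ∈ L := hmemL.2 ⟨h, by omega⟩
    have hmax := L.max'_mem ⟨0, h0L⟩
    have hmax' := hmemL.1 hmax
    have hgap : 2 ≤ m' - m := by
      have := hlt _ hmax'.1 hmax'.2
      rcases mem_insert.1 (hshift _ hmax) with h2 | h2
      · omega
      · have := L.le_max' _ h2
        omega
    have hsub : insert 0 (insert 1 (L.image (· + (m' - m)))) ⊆ insert m L := by
      refine insert_subset (mem_insert_of_mem h0L) (insert_subset (mem_insert_of_mem h1L) ?_)
      intro x hx
      obtain ⟨u, hu, rfl⟩ := mem_image.1 hx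
      exact hshift u hu
    have hL0 : ∀ u ∈ L, 0 ≤ u := fun u hu => hP.left_le u (hmemL.1 hu).1
    have hc := card_le_card hsub
    rw [card_insert_of_notMem, card_insert_of_notMem,
      card_image_of_injective _ (add_left_injective _), card_insert_of_notMem] at hc
    · omega
    · simp [hmemL]
    · intro hx
      obtain ⟨u, hu, hu'⟩ := mem_image.1 hx
      have := hL0 u hu
      omega
    · intro hx
      rcases mem_insert.1 hx with hx | hx
      · omega
      obtain ⟨u, hu, hu'⟩ := mem_image.1 hx
      have := hL0 u hu
      omega
  · have hT2 := h1 h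
    have hlt0 : ∀ a ∈ A, a < m → a = 0 := fun a ha ham => by
      have := hP.left_le a ha
      have := hlt a ha ham
      omega
    have hex : ∃ x ∈ A, ¬ m ∣ x := by
      by_contra! hall
      have := hP.isUnit_of_dvd m (by simpa using hall)
      rw [Int.isUnit_iff] at this
      omega
    obtain ⟨x, ⟨hxA, hmx⟩, hmin⟩ := Int.exists_least_of_bdd (P := fun y => y ∈ A ∧ ¬ m ∣ y)
      ⟨0, fun z hz => hP.left_le z hz.1⟩ hex
    have hxm : m ≤ x := by
      by_contra hlt
      exact hmx (by rw [hlt0 x hxA (by omega)]; exact dvd_zero m)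
    refine ⟨x, mem_add.2 ⟨0, hP.left_mem, x, hxA, zero_add x⟩, hxm, ?_, ?_⟩
    · rintro a ha ham rfl
      rcases ham.lt_or_eq with ham | rfl
      · exact hmx (by rw [hlt0 a ha ham, add_zero])
      · exact hmx (dvd_add dvd_rfl dvd_rfl)
    · rintro a ha hma b hb hmb rfl
      have hda : m ∣ a := by
        by_contra hn
        have := hmin a ⟨ha, hn⟩
        omega
      have hdb : m ∣ b := by
        by_contra hn
        have := hmin b ⟨hb, hn⟩
        omega
      exact hmx (dvd_add hda hdb)

/-- Cutting at an element above a dense block, when the upper part is primitive. -/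
lemma three_mul_card_le_of_primitive_upper {A : Finset ℤ} {N T m : ℤ} (ih : FreimanBelow A.card)
    (hP : A.IsPrimitiveOn 0 N) (hlow : Icc 0 (T - 2) ⊆ A + A) (hT0 : 1 < T)
    (hT : T = 2 * ((A.filter (· < m)).card : ℤ)) (hTm : T ≤ m) (hm : m ∈ A) (hmN : m < N)
    (hlt : ∀ a ∈ A, a < m → a < T - 1) (h1 : 1 ∉ A → T = 2)
    (hmT : m - T ≤ N + 2 - 2 * (A.card : ℤ))
    (hprim : (A.filter (m ≤ ·)).IsPrimitiveOn m N) :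
    3 * A.card ≤ (A + A).card + 3 := by
  obtain ⟨z, hz, hmz, hz1, hz2⟩ := exists_mem_add_self_new hP hT0 hT hTm hm hmN hlt h1
  set L := A.filter (· < m) with hL
  set C := A.filter (m ≤ ·) with hC
  have hLC := A.card_filter_lt_add_card_filter_ge m
  rw [← hL, ← hC] at hLC
  have hmemL : ∀ {y}, y ∈ L ↔ y ∈ A ∧ y < m := by simp [hL]
  have hmemC : ∀ {y}, y ∈ C ↔ y ∈ A ∧ m ≤ y := by simp [hC]
  have hCC := ih C (by omega) m N hprim (by omega)
  have hsub : insert z ((Icc 0 (T - 2) ∪ L.image (m + ·)) ∪ (C + C)) ⊆ A + A := by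
    refine insert_subset hz (union_subset (union_subset hlow fun x hx => ?_)
      (add_subset_add (filter_subset _ _) (filter_subset _ _)))
    obtain ⟨a, ha, rfl⟩ := mem_image.1 hx
    exact add_mem_add hm (hmemL.1 ha).1
  have hd1 : Disjoint (Icc 0 (T - 2)) (L.image (m + ·)) := by
    rw [disjoint_left]
    intro x hx hx'
    obtain ⟨a, ha, rfl⟩ := mem_image.1 hx'
    have := hP.left_le a (hmemL.1 ha).1
    rw [mem_Icc] at hx
    omega
  have hd2 : Disjoint (Icc 0 (T - 2) ∪ L.image (m + ·)) (C + C) := by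
    rw [disjoint_left]
    intro x hx hx'
    obtain ⟨u, hu, v, hv, rfl⟩ := mem_add.1 hx'
    have := (hmemC.1 hu).2
    have := (hmemC.1 hv).2
    rcases mem_union.1 hx with hx | hx
    · rw [mem_Icc] at hx
      omega
    · obtain ⟨a, ha, hau⟩ := mem_image.1 hx
      have := (hmemL.1 ha).2
      omega
  have hz3 : z ∉ (Icc 0 (T - 2) ∪ L.image (m + ·)) ∪ (C + C) := by
    intro hx
    rcases mem_union.1 hx with hx | hx
    · rcases mem_union.1 hx with hx | hx
      · rw [mem_Icc] at hx
        omega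
      · obtain ⟨a, ha, hau⟩ := mem_image.1 hx
        exact hz1 a (hmemL.1 ha).1 (hmemL.1 ha).2.le hau.symm
    · obtain ⟨u, hu, v, hv, huv⟩ := mem_add.1 hx
      exact hz2 u (hmemC.1 hu).1 (hmemC.1 hu).2 v (hmemC.1 hv).1 (hmemC.1 hv).2 huv.symm
  have hc := card_le_card hsub
  rw [card_insert_of_notMem hz3, card_union_of_disjoint hd2, card_union_of_disjoint hd1,
    card_image_of_injective _ (add_right_injective m), Int.card_Icc] at hc
  omega

lemma excess_of_le {A : Finset ℤ} (hA : ∀ a ∈ A, 0 ≤ a) {x : ℤ} (hx : x ≤ 0) :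
    A.excess x = x := by
  rw [excess, filter_false_of_mem fun a ha => by have := hA a ha; omega]
  simp

/-- The inductive step: sets in `[0, N]` with many missing elements. -/
lemma three_mul_card_le_of_freimanBelow {A : Finset ℤ} {N : ℤ} (ih : FreimanBelow A.card)
    (hP : A.IsPrimitiveOn 0 N) (hN : 2 * (A.card : ℤ) ≤ N + 2) :
    3 * A.card ≤ (A + A).card + 3 := by
  have hA := hP.left_le
  have hA' := hP.le_right
  have e0 : A.excess 0 = 0 := excess_of_le hA le_rfl
  have e1 : A.excess 1 = -1 := by
    simpa [e0] using excess_succ_of_mem hP.left_mem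
  have eN : A.excess N = N + 2 - 2 * (A.card : ℤ) := by
    have h := excess_succ_of_mem hP.right_mem
    rw [excess, filter_true_of_mem fun a ha => by have := hA' a ha; omega] at h
    omega
  have hN1 : 1 ≤ N := by
    have := hA N hP.right_mem
    by_contra hlt
    obtain rfl : N = 0 := by omega
    have h0 := hP.isUnit_of_dvd 0 fun a ha => by
      rw [show a = 0 from le_antisymm (hA' a ha) (hA a ha)]
      simp
    exact not_isUnit_zero h0
  obtain ⟨T, hT1, hTN, hT, hTlt⟩ := exists_first_eq A.excess_succ_le hN1 (v := 0)
    (by omega) (by omega)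
  obtain ⟨U, hU1, hUN, hU, hUgt⟩ := exists_last_eq A.excess_succ_le hN1
    (v := N + 1 - 2 * (A.card : ℤ)) (by omega) (by omega)
  have hTA : T - 1 ∉ A := fun h => by
    have h1 := excess_succ_of_mem h
    have h2 := hTlt (T - 1) (by omega) (by omega)
    rw [sub_add_cancel] at h1
    omega
  have hUA : U ∉ A := fun h => by
    have h1 := excess_succ_of_mem h
    have h2 := hUgt (U + 1) (by omega) (by omega)
    omega
  have hTU : T ≤ U + 1 := by
    by_contra hlt
    have h1 := hTlt (U + 1) (by omega) (by omega)
    have h2 := hUgt (U + 1) (by omega) (by omega)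
    omega
  by_cases hgap : ∃ a, a ∈ A ∧ T ≤ a ∧ a < U
  swap
  · push Not at hgap
    refine three_mul_card_le_of_two_blocks hP.left_mem hP.right_mem hA hA' hT1 hUN hT hU hTU
      hTlt hUgt fun a ha hTa => ?_
    have h1 : a ≠ T - 1 := fun h => hTA (h ▸ ha)
    have h2 : a ≠ U := fun h => hUA (h ▸ ha)
    have := hgap a ha (by omega)
    omega
  obtain ⟨m, ⟨hm, hTm, hmU⟩, hmin⟩ := Int.exists_least_of_bdd ⟨T, fun z hz => hz.2.1⟩ hgap
  have hlt : ∀ a ∈ A, a < m → a < T - 1 := fun a ha ham => by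
    have h1 : a ≠ T - 1 := fun h => hTA (h ▸ ha)
    have := fun h => hmin a ⟨ha, h, by omega⟩
    omega
  have hfil : A.filter (· < m) = A.filter (· < T) := by
    ext y
    simp only [mem_filter]
    refine and_congr_right fun hy => ?_
    have := hlt y hy
    omega
  have hTc : T = 2 * ((A.filter (· < m)).card : ℤ) := by
    rw [hfil]
    unfold excess at hT
    omega
  have em : A.excess m = m - T := by
    rw [excess, ← hTc]
  have hlow : Icc 0 (T - 2) ⊆ A + A := fun x hx => by
    rw [mem_Icc] at hx
    exact mem_add_self_of_excess_neg hA hx.1 (hTlt _ (by omega) (by omega))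
  by_cases hmT : m - T ≤ N + 2 - 2 * (A.card : ℤ)
  · by_cases hdvd : ∃ d : ℤ, ¬ IsUnit d ∧ ∀ a ∈ A, m ≤ a → d ∣ a - m
    · obtain ⟨d, hd, hdvd⟩ := hdvd
      exact three_mul_card_le_of_dvd_upper hP hlow hTc hTm hm hd hdvd
    · push Not at hdvd
      refine three_mul_card_le_of_primitive_upper ih hP hlow hT1 hTc hTm hm (by omega) hlt
        (fun h1 => ?_) hmT ⟨by simp [hm], by simp [hP.right_mem]; omega, by simp, ?_, ?_⟩
      · have h2 := excess_succ_of_notMem h1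
        by_contra hne
        have := hTlt (1 + 1) (by omega) (by omega)
        omega
      · exact fun a ha => hA' a (filter_subset _ _ ha)
      · intro d hd
        by_contra hu
        obtain ⟨a, ha, hma, hda⟩ := hdvd d hu
        exact hda (hd a (mem_filter.2 ⟨ha, hma⟩))
  · obtain ⟨x, hmx, hxU, hx, hxgt⟩ := exists_last_eq (f := fun y => - A.excess y)
      (a := m) (b := U) (v := -(N + 3 - 2 * (A.card : ℤ)))
      (fun y => by have := A.le_excess_succ y; omega) (by omega) (by omega) (by omega)
    have h1 := hxgt (x + 1) (by omega) (by omega)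
    have hxA : x ∈ A := by
      by_contra hn
      have := excess_succ_of_notMem hn
      omega
    have h2 := excess_succ_of_mem hxA
    have hxU' : x + 1 ≠ U := by rintro rfl; omega
    have h3 := hxgt (x + 1 + 1) (by omega) (by omega)
    have hxA' : x + 1 ∈ A := by
      by_contra hn
      have := A.excess_succ_le (x + 1)
      have := excess_succ_of_notMem hn
      omega
    exact three_mul_card_le_of_consecutive ih hP.left_mem hP.right_mem hA hA' hxA hxA'
      (by omega) (by omega) (by omega) (by omega)

lemma freimanBelow (k : ℕ) : FreimanBelow k := by
  induction k with
  | zero => exact fun B hB => absurd hB (by omega)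
  | succ k ih =>
    intro B hB m M hP hM
    set A := B.image (· - m) with hA
    have hAc : A.card = B.card := card_image_of_injective _ sub_left_injective
    have hAA : (A + A).card ≤ (B + B).card := by
      refine (card_le_card (t := (B + B).image (· - 2 * m)) fun x hx => ?_).trans card_image_le
      obtain ⟨u, hu, v, hv, rfl⟩ := mem_add.1 hx
      obtain ⟨a, ha, rfl⟩ := mem_image.1 hu
      obtain ⟨b, hb, rfl⟩ := mem_image.1 hv
      exact mem_image.2 ⟨a + b, add_mem_add ha hb, by ring⟩
    have hPA : A.IsPrimitiveOn 0 (M - m) := by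
      refine ⟨mem_image.2 ⟨m, hP.left_mem, sub_self m⟩, mem_image.2 ⟨M, hP.right_mem, rfl⟩,
        ?_, ?_, fun d hd => hP.isUnit_of_dvd d fun a ha => ?_⟩
      · simpa [hA] using hP.left_le
      · simpa [hA] using hP.le_right
      · simpa using hd (a - m) (mem_image_of_mem _ ha)
    by_cases hMk : M - m + 3 = 2 * (A.card : ℤ)
    · have := card_add_le_card_add_self_of_dense hPA.left_mem hPA.right_mem hPA.left_le
        hPA.le_right hMk.le
      omega
    · have := three_mul_card_le_of_freimanBelow
        (fun C hC => ih C (by omega)) hPA (by omega)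
      omega

end Finset

/-- Freiman's `3k-4` theorem, symmetric reformulation (inequality (3) of the paper):
`|A+A| ≥ min(3|A| - 3, |A| + N_A)` where `N_A = (max A - min A) / gcd*(A)` and
`gcd*(A)` is the gcd of the elements of `A - min A`. -/
theorem freiman_3k4_symmetric (A : Finset ℤ) (hne : A.Nonempty) (hcard : 2 ≤ A.card) :
    min (3 * (A.card : ℤ) - 3)
        ((A.card : ℤ) +
          (A.max' hne - A.min' hne) / (A.image fun a => a - A.min' hne).gcd id) ≤
      ((A + A).card : ℤ) := by
  set m := A.min' hne with hm
  set M := A.max' hne with hM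
  set g := (A.image fun a => a - m).gcd id with hg
  have hmA : m ∈ A := A.min'_mem hne
  have hMA : M ∈ A := A.max'_mem hne
  have hmM : m < M := A.min'_lt_max'_of_card (by omega)
  have hgd : ∀ a ∈ A, g ∣ a - m := fun a ha => Finset.gcd_dvd (Finset.mem_image_of_mem _ ha)
  have hg0 : 0 < g := by
    refine lt_of_le_of_ne ?_ fun h => ?_
    · exact Int.nonneg_of_normalize_eq_self Finset.normalize_gcd
    · have := hgd M hMA
      rw [← h, zero_dvd_iff] at this
      omega
  set B := A.image (fun a => (a - m) / g) with hB
  have hBc : B.card = A.card := by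
    refine Finset.card_image_of_injOn fun a ha b hb hab => ?_
    have := (Int.ediv_left_inj (hgd a ha) (hgd b hb)).1 hab
    omega
  have hBB : (B + B).card ≤ (A + A).card := by
    refine (Finset.card_le_card (t := (A + A).image fun s => (s - 2 * m) / g)
      fun x hx => ?_).trans Finset.card_image_le
    obtain ⟨u, hu, v, hv, rfl⟩ := Finset.mem_add.1 hx
    obtain ⟨a, ha, rfl⟩ := Finset.mem_image.1 hu
    obtain ⟨b, hb, rfl⟩ := Finset.mem_image.1 hv
    refine Finset.mem_image.2 ⟨a + b, Finset.add_mem_add ha hb, ?_⟩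
    rw [← Int.add_ediv_of_dvd_left (hgd a ha)]
    congr 1
    ring
  have hP : B.IsPrimitiveOn 0 ((M - m) / g) := by
    refine ⟨Finset.mem_image.2 ⟨m, hmA, by simp⟩, Finset.mem_image.2 ⟨M, hMA, rfl⟩, ?_, ?_, ?_⟩
    · intro x hx
      obtain ⟨a, ha, rfl⟩ := Finset.mem_image.1 hx
      have := A.min'_le a ha
      exact Int.ediv_nonneg (by omega) hg0.le
    · intro x hx
      obtain ⟨a, ha, rfl⟩ := Finset.mem_image.1 hx
      have := A.le_max' a ha
      exact Int.ediv_le_ediv hg0 (by omega)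
    · intro d hd
      have hdg : g * d ∣ g := by
        conv_rhs => rw [hg]
        refine Finset.dvd_gcd fun x hx => ?_
        obtain ⟨a, ha, rfl⟩ := Finset.mem_image.1 hx
        have := hd _ (Finset.mem_image_of_mem _ ha)
        rw [sub_zero] at this
        have := mul_dvd_mul_left g this
        rwa [Int.mul_ediv_cancel' (hgd a ha)] at this
      exact isUnit_of_dvd_one ((mul_dvd_mul_iff_left hg0.ne').1 (by simpa using hdg))
  by_cases h : 2 * (B.card : ℤ) ≤ (M - m) / g - 0 + 3
  · have := Finset.freimanBelow (B.card + 1) B (by omega) 0 _ hP h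
    exact (min_le_left _ _).trans (by omega)
  · have := Finset.card_add_le_card_add_self_of_dense hP.left_mem hP.right_mem hP.left_le
      hP.le_right (by omega)
    exact (min_le_right _ _).trans (by omega)
end

section
/- Let A and B be finite nonempty subsets of ℤ with |B| ≤ |A|. Set δ = 1 if A is a translate of B and δ = 0 otherwise. Assume |A + B| ≤ |A| + 2|B| − 3 − δ. Then there exist arithmetic progressions P_A, P_B, and P_{A+B} with a common difference such that A ⊆ P_A, B ⊆ P_B, P_{A+B} ⊆ A + B, and |P_A| ≤ |A + B| − |B| + 1, |P_B| ≤ |A + B| − |A| + 1, |P_{A+B}| ≥ |A| + |B| − 1. -/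
open Pointwise
open scoped Classical

namespace Freiman

section Kneser

variable {G : Type*} [AddCommGroup G]

/-- The subgroup of periods of a set in an abelian group. -/
def periods (C : Finset G) : AddSubgroup G where
  carrier := {g | ∀ c, g + c ∈ C ↔ c ∈ C}
  zero_mem' := by simp
  add_mem' := by
    intro x y hx hy c
    rw [add_assoc, hx, hy]
  neg_mem' := by
    intro x hx c
    have := hx (-x + c)
    rw [add_neg_cancel_left] at this
    exact this.symm

lemma mem_periods {C : Finset G} {g : G} : g ∈ periods C ↔ ∀ c, g + c ∈ C ↔ c ∈ C := Iff.rfl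

variable [Fintype G]

/-- The elements of a subgroup of a finite group, as a finset. -/
noncomputable def elems (H : AddSubgroup G) : Finset G := Finset.univ.filter (· ∈ H)

@[simp] lemma mem_elems {H : AddSubgroup G} {x : G} : x ∈ elems H ↔ x ∈ H := by simp [elems]

lemma card_elems_pos (H : AddSubgroup G) : 0 < (elems H).card :=
  Finset.card_pos.mpr ⟨0, by simp⟩

lemma card_grid_le [DecidableEq G] (C₁ C₂ : Finset G) (c : G) :
    ((elems (periods C₂)).filter (fun y => c + y ∉ C₁)).card *
      ((elems (periods C₁)).filter (fun x => c + x ∈ C₂)).card ≤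
      (elems (periods C₁ ⊓ periods C₂)).card * (C₂ \ C₁).card := by
  rw [← Finset.card_product]
  refine Finset.card_le_mul_card_image_of_maps_to (f := fun p : G × G => c + p.2 + p.1) ?_ _ ?_
  · rintro ⟨y, x⟩ h
    simp only [Finset.mem_product, Finset.mem_filter, mem_elems] at h
    obtain ⟨⟨hy, hy'⟩, hx, hx'⟩ := h
    simp only [Finset.mem_sdiff]
    constructor
    · rw [add_comm]; exact (hy _).2 hx'
    · rw [show c + x + y = x + (c + y) by abel]
      exact fun h => hy' ((hx _).1 h)
  · intro d _
    rcases Finset.eq_empty_or_nonempty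
      ((((elems (periods C₂)).filter (fun y => c + y ∉ C₁)) ×ˢ
      ((elems (periods C₁)).filter (fun x => c + x ∈ C₂))).filter
        (fun p : G × G => c + p.2 + p.1 = d)) with h | ⟨⟨y₀, x₀⟩, h₀⟩
    · rw [h]; simp
    · simp only [Finset.mem_product, Finset.mem_filter, mem_elems] at h₀
      obtain ⟨⟨⟨hy₀, _⟩, hx₀, _⟩, he₀⟩ := h₀
      refine Finset.card_le_card_of_injOn (fun p => p.1 - y₀) ?_ ?_
      · rintro ⟨y, x⟩ h
        simp only [Finset.coe_filter, Finset.mem_product, Finset.mem_filter, mem_elems,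
          Set.mem_ofPred_eq] at h
        obtain ⟨⟨⟨hy, _⟩, hx, _⟩, he⟩ := h
        simp only [Finset.mem_coe, mem_elems, AddSubgroup.mem_inf]
        refine ⟨?_, sub_mem hy hy₀⟩
        have : y - y₀ = x₀ - x := by
          rw [sub_eq_sub_iff_add_eq_add]
          have := he.trans he₀.symm
          rw [add_assoc, add_assoc] at this
          rw [add_comm y x]
          exact add_left_cancel this
        rw [this]
        exact sub_mem hx₀ hx
      · rintro ⟨y, x⟩ h ⟨y', x'⟩ h' hyy
        simp only [Finset.coe_filter, Finset.mem_product, Finset.mem_filter, mem_elems,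
          Set.mem_ofPred_eq] at h h'
        have hy : y = y' := by simpa using hyy
        subst hy
        have := h.2.trans h'.2.symm
        simpa using this

lemma card_le_of_translate_mem (H : AddSubgroup G) {S : Finset G} {y : G}
    (h : ∀ k ∈ H, k + y ∈ S) : (elems H).card ≤ S.card :=
  Finset.card_le_card_of_injOn (fun k => k + y) (fun k hk => h k (by simpa using hk))
    (fun k _ k' _ hkk => by simpa using hkk)

lemma grid_arith {k S Q S' Q' X Y : ℕ} (hS : k ≤ S) (hQ : k ≤ Q) (hS' : k ≤ S') (hQ' : k ≤ Q')
    (h₁ : S * Q ≤ k * X) (h₂ : S' * Q' ≤ k * Y) (hk : 0 < k) :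
    Q + S' ≤ X + k ∨ S + Q' ≤ Y + k := by
  by_contra! h
  obtain ⟨hX, hY⟩ := h
  obtain ⟨s, rfl⟩ := Nat.exists_eq_add_of_le hS
  obtain ⟨q, rfl⟩ := Nat.exists_eq_add_of_le hQ
  obtain ⟨s', rfl⟩ := Nat.exists_eq_add_of_le hS'
  obtain ⟨q', rfl⟩ := Nat.exists_eq_add_of_le hQ'
  have e₁ : k * X < k * (k + q + s') := by
    apply Nat.mul_lt_mul_of_pos_left _ hk; omega
  have e₂ : k * Y < k * (k + s + q') := by
    apply Nat.mul_lt_mul_of_pos_left _ hk; omega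
  nlinarith [Nat.zero_le (s * q), Nat.zero_le (s' * q')]

lemma card_sdiff_add_card_inf [DecidableEq G] (C₁ C₂ : Finset G) (c : G) (h₂ : c ∈ C₂) (h₁ : c ∉ C₁) :
    (elems (periods C₁)).card ≤
        (C₂ \ C₁).card + (elems (periods C₁ ⊓ periods C₂)).card ∨
      (elems (periods C₂)).card ≤
        (C₁ \ C₂).card + (elems (periods C₁ ⊓ periods C₂)).card ∨
      (elems (periods C₂)).card ≤ (C₂ \ C₁).card := by
  have g₁ := card_grid_le C₁ C₂ c
  have g₂ := card_grid_le C₂ C₁ c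
  rw [inf_comm] at g₂
  have e₁ := Finset.card_filter_add_card_filter_not (s := elems (periods C₁))
    (fun x => c + x ∈ C₂)
  have e₂ := Finset.card_filter_add_card_filter_not (s := elems (periods C₂))
    (fun x => c + x ∈ C₁)
  have hk := card_elems_pos (periods C₁ ⊓ periods C₂)
  have hS : (elems (periods C₁ ⊓ periods C₂)).card ≤
      ((elems (periods C₂)).filter (fun y => c + y ∉ C₁)).card := by
    refine card_le_of_translate_mem _ (y := 0) fun k hk => ?_
    simp only [Finset.mem_filter, mem_elems, add_zero]
    exact ⟨hk.2, fun h => h₁ ((hk.1 c).1 (by rwa [add_comm]))⟩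
  have hQ : (elems (periods C₁ ⊓ periods C₂)).card ≤
      ((elems (periods C₁)).filter (fun y => c + y ∈ C₂)).card := by
    refine card_le_of_translate_mem _ (y := 0) fun k hk => ?_
    simp only [Finset.mem_filter, mem_elems, add_zero]
    exact ⟨hk.1, by rw [add_comm]; exact (hk.2 c).2 h₂⟩
  rcases Finset.eq_empty_or_nonempty ((elems (periods C₁)).filter (fun x => c + x ∉ C₂)) with
    hE | ⟨x, hx⟩
  · left
    rw [hE, Finset.card_empty] at e₁
    have := Nat.le_of_mul_le_mul_left ((Nat.mul_le_mul_right _ hS).trans g₁) hk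
    omega
  rcases Finset.eq_empty_or_nonempty ((elems (periods C₂)).filter (fun x => c + x ∈ C₁)) with
    hE | ⟨y, hy⟩
  · right; right
    rw [hE, Finset.card_empty] at e₂
    rw [mul_comm] at g₁
    have := Nat.le_of_mul_le_mul_left ((Nat.mul_le_mul_right _ hQ).trans g₁) hk
    omega
  simp only [Finset.mem_filter, mem_elems] at hx hy
  have hS' : (elems (periods C₁ ⊓ periods C₂)).card ≤
      ((elems (periods C₁)).filter (fun y => c + y ∉ C₂)).card := by
    refine card_le_of_translate_mem _ (y := x) fun k hk => ?_
    simp only [Finset.mem_filter, mem_elems]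
    refine ⟨add_mem hk.1 hx.1, fun h => hx.2 ((hk.2 _).1 ?_)⟩
    rwa [add_left_comm]
  have hQ' : (elems (periods C₁ ⊓ periods C₂)).card ≤
      ((elems (periods C₂)).filter (fun y => c + y ∈ C₁)).card := by
    refine card_le_of_translate_mem _ (y := y) fun k hk => ?_
    simp only [Finset.mem_filter, mem_elems]
    refine ⟨add_mem hk.2 hy.1, ?_⟩
    rw [add_left_comm]
    exact (hk.1 _).2 hy.2
  rcases grid_arith hS hQ hS' hQ' g₁ g₂ hk with h | h
  · left; omega
  · right; left; omega

/-- Kneser's lemma on unions. -/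
lemma le_card_union_add_card_periods [DecidableEq G] {C₁ C₂ : Finset G} {n : ℕ}
    (h₁₂ : ¬ C₁ ⊆ C₂) (h₂₁ : ¬ C₂ ⊆ C₁)
    (h₁ : n ≤ C₁.card + (elems (periods C₁)).card)
    (h₂ : n ≤ C₂.card + (elems (periods C₂)).card) :
    n ≤ (C₁ ∪ C₂).card + (elems (periods (C₁ ∪ C₂))).card := by
  obtain ⟨c, hc₁, hc₂⟩ := Finset.not_subset.1 h₁₂
  obtain ⟨d, hd₂, hd₁⟩ := Finset.not_subset.1 h₂₁
  have f₁ := card_sdiff_add_card_inf C₁ C₂ d hd₂ hd₁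
  have f₂ := card_sdiff_add_card_inf C₂ C₁ c hc₁ hc₂
  rw [inf_comm] at f₂
  have hle : (elems (periods C₁ ⊓ periods C₂)).card ≤ (elems (periods (C₁ ∪ C₂))).card := by
    refine Finset.card_le_card fun k hk => ?_
    simp only [mem_elems, AddSubgroup.mem_inf] at hk ⊢
    intro x
    simp only [Finset.mem_union, hk.1 x, hk.2 x]
  have u₁ : (C₁ ∪ C₂).card = C₁.card + (C₂ \ C₁).card := by
    rw [← Finset.union_sdiff_self_eq_union, Finset.card_union_of_disjoint Finset.disjoint_sdiff]
  have u₂ : (C₁ ∪ C₂).card = C₂.card + (C₁ \ C₂).card := by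
    rw [Finset.union_comm, ← Finset.union_sdiff_self_eq_union,
      Finset.card_union_of_disjoint Finset.disjoint_sdiff]
  omega

lemma exists_dyson_limit [DecidableEq G] (n : ℕ) : ∀ (A B : Finset G), B.card = n → 0 ∈ A → 0 ∈ B →
    ∃ C ⊆ A + B, 0 ∈ C ∧ A.card + B.card ≤ C.card + (elems (periods C)).card := by
  induction n using Nat.strong_induction_on with
  | _ n ih =>
  intro A B hn hA hB
  by_cases h : ∀ e ∈ A, ∀ b ∈ B, e + b ∈ A
  · refine ⟨A, fun x hx => Finset.mem_add.2 ⟨x, hx, 0, hB, add_zero x⟩, hA, ?_⟩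
    gcongr
    intro b hb
    rw [mem_elems, mem_periods]
    have himg : A.image (fun c => b + c) = A := by
      apply Finset.eq_of_subset_of_card_le
      · intro x hx
        obtain ⟨c, hc, rfl⟩ := Finset.mem_image.1 hx
        rw [add_comm]
        exact h c hc b hb
      · rw [Finset.card_image_of_injective _ (add_right_injective b)]
    intro c
    conv_lhs => rw [← himg]
    simp
  · push Not at h
    obtain ⟨e, he, b, hb, heb⟩ := h
    set B' := B.filter (fun x => e + x ∈ A) with hB'
    set A' := A ∪ B.image (fun x => e + x) with hA'
    have hlt : B'.card < n := by
      rw [← hn]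
      apply Finset.card_lt_card
      refine ⟨Finset.filter_subset _ _, fun hs => heb ?_⟩
      exact (Finset.mem_filter.1 (hs hb)).2
    obtain ⟨C, hC, h0, hcard⟩ := ih _ hlt A' B' rfl (Finset.mem_union_left _ hA)
      (by simp [hB', hB, he])
    refine ⟨C, hC.trans ?_, h0, ?_⟩
    · intro x hx
      obtain ⟨y, hy, z, hz, rfl⟩ := Finset.mem_add.1 hx
      simp only [hB', Finset.mem_filter] at hz
      rcases Finset.mem_union.1 hy with hy | hy
      · exact Finset.add_mem_add hy hz.1
      · obtain ⟨w, hw, rfl⟩ := Finset.mem_image.1 hy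
        exact Finset.mem_add.2 ⟨e + z, hz.2, w, hw, by abel⟩
    · refine le_trans (le_of_eq ?_) hcard
      have hi : (A ∩ B.image (fun x => e + x)).card = B'.card := by
        rw [← Finset.card_image_of_injective B' (add_right_injective e)]
        congr 1
        ext x
        simp only [Finset.mem_inter, Finset.mem_image, hB', Finset.mem_filter]
        constructor
        · rintro ⟨hx, y, hy, rfl⟩
          exact ⟨y, ⟨hy, hx⟩, rfl⟩
        · rintro ⟨y, ⟨hy, hx⟩, rfl⟩
          exact ⟨hx, y, hy, rfl⟩
      have := Finset.card_union_add_card_inter A (B.image (fun x => e + x))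
      rw [hi, Finset.card_image_of_injective _ (add_right_injective e)] at this
      exact this.symm

lemma exists_local_kneser [DecidableEq G] (A B : Finset G) (c : G) (hc : c ∈ A + B) :
    ∃ C ⊆ A + B, c ∈ C ∧ A.card + B.card ≤ C.card + (elems (periods C)).card := by
  obtain ⟨x, hx, y, hy, rfl⟩ := Finset.mem_add.1 hc
  obtain ⟨C, hC, h0, hcard⟩ := exists_dyson_limit _ (A.image (fun z => -x + z))
    (B.image (fun z => -y + z)) rfl (Finset.mem_image.2 ⟨x, hx, by simp⟩)
    (Finset.mem_image.2 ⟨y, hy, by simp⟩)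
  refine ⟨C.image (fun z => (x + y) + z), ?_, Finset.mem_image.2 ⟨0, h0, by simp⟩, ?_⟩
  · intro z hz
    obtain ⟨w, hw, rfl⟩ := Finset.mem_image.1 hz
    obtain ⟨p, hp, q, hq, rfl⟩ := Finset.mem_add.1 (hC hw)
    obtain ⟨p', hp', rfl⟩ := Finset.mem_image.1 hp
    obtain ⟨q', hq', rfl⟩ := Finset.mem_image.1 hq
    exact Finset.mem_add.2 ⟨p', hp', q', hq', by abel⟩
  · rw [Finset.card_image_of_injective _ (add_right_injective _),
      Finset.card_image_of_injective _ (add_right_injective _)] at hcard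
    rw [Finset.card_image_of_injective _ (add_right_injective _)]
    refine hcard.trans ?_
    gcongr
    intro g hg
    rw [mem_elems, mem_periods] at hg ⊢
    have key : ∀ u, u ∈ C.image (fun z => (x + y) + z) ↔ -(x + y) + u ∈ C := by
      intro u
      rw [Finset.mem_image]
      constructor
      · rintro ⟨z, hz, rfl⟩
        rwa [neg_add_cancel_left]
      · intro h
        exact ⟨_, h, by abel⟩
    intro u
    rw [key, key, add_left_comm, hg]

/-- A weak form of Kneser's theorem. -/
lemma card_add_card_le_card_add_periods [DecidableEq G] (A B : Finset G) (hA : A.Nonempty)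
    (hB : B.Nonempty) :
    A.card + B.card ≤ (A + B).card + (elems (periods (A + B))).card := by
  obtain ⟨c₀, hc₀⟩ := hA.add hB
  set F := (A + B).powerset.filter
    (fun C => A.card + B.card ≤ C.card + (elems (periods C)).card) with hF
  have hne : F.Nonempty := by
    obtain ⟨C, hC, -, h⟩ := exists_local_kneser A B c₀ hc₀
    exact ⟨C, by simp [hF, hC, h]⟩
  obtain ⟨C, hCF, hmax⟩ := F.exists_max_image Finset.card hne
  obtain ⟨hC, hcard⟩ : C ⊆ A + B ∧ A.card + B.card ≤ C.card + (elems (periods C)).card := by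
    simpa [hF] using hCF
  by_cases heq : A + B ⊆ C
  · rwa [Finset.Subset.antisymm heq hC]
  exfalso
  obtain ⟨c, hc, hcC⟩ := Finset.not_subset.1 heq
  obtain ⟨C', hC', hcC', hcard'⟩ := exists_local_kneser A B c hc
  by_cases hsub : C ⊆ C'
  · have := hmax C' (by simp [hF, hC', hcard'])
    exact absurd (Finset.card_lt_card ⟨hsub, fun h => hcC (h hcC')⟩) (by omega)
  · have hU := le_card_union_add_card_periods hsub (fun h => hcC (h hcC')) hcard hcard'
    have := hmax (C ∪ C') (by simp [hF, Finset.union_subset hC hC', hU])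
    exact absurd (Finset.card_lt_card ⟨Finset.subset_union_left, fun h => hcC (h
      (Finset.mem_union_right C hcC'))⟩) (by omega)

/-- Kneser's theorem for finite abelian groups. -/
theorem kneser [DecidableEq G] (A B : Finset G) (hA : A.Nonempty) (hB : B.Nonempty) :
    (A + elems (periods (A + B))).card + (B + elems (periods (A + B))).card ≤
      (A + B).card + (elems (periods (A + B))).card := by
  have h : (A + elems (periods (A + B))) + (B + elems (periods (A + B))) = A + B := by
    ext x
    constructor
    · intro hx
      obtain ⟨y, hy, z, hz, rfl⟩ := Finset.mem_add.1 hx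
      obtain ⟨p, hp, k, hk, rfl⟩ := Finset.mem_add.1 hy
      obtain ⟨q, hq, l, hl, rfl⟩ := Finset.mem_add.1 hz
      rw [mem_elems] at hk hl
      rw [show p + k + (q + l) = k + (l + (p + q)) by abel]
      exact (hk _).2 ((hl _).2 (Finset.add_mem_add hp hq))
    · intro hx
      obtain ⟨y, hy, z, hz, rfl⟩ := Finset.mem_add.1 hx
      have h0 : (0 : G) ∈ elems (periods (A + B)) := by simp
      exact Finset.add_mem_add (Finset.mem_add.2 ⟨y, hy, 0, h0, add_zero y⟩)
        (Finset.mem_add.2 ⟨z, hz, 0, h0, add_zero z⟩)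
  have h0 : (elems (periods (A + B))).Nonempty := ⟨0, by simp⟩
  have := card_add_card_le_card_add_periods _ _ (hA.add h0) (hB.add h0)
  rwa [h] at this

end Kneser

section Residues

variable {a : ℕ}

lemma card_residues_add_card_le (ha : 0 < a) {C E : Finset ℤ} (hE : E ⊆ C)
    (hEa : ∀ e ∈ E, e + a ∈ C) :
    (C.image (Int.cast : ℤ → ZMod a)).card + E.card ≤ C.card := by
  have hsub : E.image (fun e => e + (a : ℤ)) ⊆ C := by
    intro x hx
    obtain ⟨e, he, rfl⟩ := Finset.mem_image.1 hx
    exact hEa e he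
  have himg : C.image (Int.cast : ℤ → ZMod a) ⊆
      (C \ E.image (fun e => e + (a : ℤ))).image (Int.cast : ℤ → ZMod a) := by
    intro z hz
    obtain ⟨c, hc, rfl⟩ := Finset.mem_image.1 hz
    obtain ⟨m, hm, hmin⟩ := (C.filter (fun x : ℤ => (x : ZMod a) = c)).exists_min_image id
      ⟨c, by simp [hc]⟩
    simp only [Finset.mem_filter, id] at hm hmin
    refine Finset.mem_image.2 ⟨m, Finset.mem_sdiff.2 ⟨hm.1, fun h => ?_⟩, hm.2⟩
    obtain ⟨e, he, rfl⟩ := Finset.mem_image.1 h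
    have := hmin e ⟨hE he, by simpa using hm.2⟩
    omega
  have h₁ := (Finset.card_le_card himg).trans Finset.card_image_le
  have h₂ := Finset.card_sdiff_add_card_eq_card hsub
  rw [Finset.card_image_of_injective _ (add_left_injective (a : ℤ))] at h₂
  omega

lemma card_le_card_residues_add {X : Finset ℤ} (hX : X ⊆ Finset.Icc 0 (a : ℤ)) :
    X.card ≤ (X.image (Int.cast : ℤ → ZMod a)).card + if (a : ℤ) ∈ X then 1 else 0 := by
  have hinj : Set.InjOn (Int.cast : ℤ → ZMod a) (X.erase (a : ℤ) : Finset ℤ) := by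
    intro x hx y hy hxy
    simp only [Finset.coe_erase, Set.mem_sdiff, Finset.mem_coe, Set.mem_singleton_iff] at hx hy
    have hx' := Finset.mem_Icc.1 (hX hx.1)
    have hy' := Finset.mem_Icc.1 (hX hy.1)
    have := (ZMod.intCast_eq_intCast_iff' x y a).1 hxy
    rwa [Int.emod_eq_of_lt hx'.1 (lt_of_le_of_ne hx'.2 hx.2),
      Int.emod_eq_of_lt hy'.1 (lt_of_le_of_ne hy'.2 hy.2)] at this
  have h₁ := Finset.card_image_of_injOn hinj
  have h₂ := Finset.card_le_card
    (Finset.image_subset_image (f := (Int.cast : ℤ → ZMod a)) (X.erase_subset (a : ℤ)))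
  split_ifs with h
  · have := Finset.card_erase_add_one h
    omega
  · rw [Finset.erase_eq_of_notMem h] at h₁
    omega

variable [NeZero a]

lemma card_residues_add_card_coset_le (H : AddSubgroup (ZMod a)) {C E : Finset ℤ} (hE : E ⊆ C)
    (hEa : ∀ e ∈ E, e + a ∈ C) (z : ZMod a) (hz : ∀ e ∈ E, (e : ZMod a) - z ∉ H) :
    (C.image (Int.cast : ℤ → ZMod a)).card + E.card +
        (C.filter (fun x : ℤ => (x : ZMod a) - z ∈ H)).card ≤
      C.card + (elems H).card := by
  have h₁ := card_residues_add_card_le (a := a) (NeZero.pos a)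
    (C := C.filter (fun x : ℤ => (x : ZMod a) - z ∉ H)) (E := E)
    (fun e he => Finset.mem_filter.2 ⟨hE he, hz e he⟩)
    (fun e he => Finset.mem_filter.2 ⟨hEa e he, by simpa using hz e he⟩)
  have h₂ : C.image (Int.cast : ℤ → ZMod a) ⊆
      (C.filter (fun x : ℤ => (x : ZMod a) - z ∉ H)).image (Int.cast : ℤ → ZMod a) ∪
        (elems H).image (fun k => k + z) := by
    intro y hy
    obtain ⟨c, hc, rfl⟩ := Finset.mem_image.1 hy
    by_cases h : (c : ZMod a) - z ∈ H
    · exact Finset.mem_union_right _ (Finset.mem_image.2 ⟨c - z, by simpa using h, by simp⟩)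
    · exact Finset.mem_union_left _
        (Finset.mem_image_of_mem _ (Finset.mem_filter.2 ⟨hc, h⟩))
  have h₃ := (Finset.card_le_card h₂).trans (Finset.card_union_le _ _)
  rw [Finset.card_image_of_injective _ (add_left_injective z)] at h₃
  have h₄ := Finset.card_filter_add_card_filter_not (s := C)
    (fun x : ℤ => (x : ZMod a) - z ∈ H)
  omega

lemma card_elems_add_card_residues_le (H : AddSubgroup (ZMod a)) {X : Finset ℤ} {x : ℤ}
    (hx : x ∈ X) :
    (elems H).card + (X.image (Int.cast : ℤ → ZMod a)).card ≤
      ((X.filter (fun y : ℤ => (y : ZMod a) - x ∈ H)).image (Int.cast : ℤ → ZMod a)).card +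
        (X.image (Int.cast : ℤ → ZMod a) + elems H).card := by
  have hsub : X.image (Int.cast : ℤ → ZMod a) ⊆ X.image (Int.cast : ℤ → ZMod a) + elems H :=
    fun y hy => Finset.mem_add.2 ⟨y, hy, 0, by simp, add_zero y⟩
  have h₁ := Finset.card_sdiff_add_card_eq_card hsub
  have h₂ : (elems H).image (fun k => (x : ZMod a) + k) ⊆
      (X.filter (fun y : ℤ => (y : ZMod a) - x ∈ H)).image (Int.cast : ℤ → ZMod a) ∪
        ((X.image (Int.cast : ℤ → ZMod a) + elems H) \ X.image (Int.cast : ℤ → ZMod a)) := by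
    intro y hy
    obtain ⟨k, hk, rfl⟩ := Finset.mem_image.1 hy
    by_cases h : (x : ZMod a) + k ∈ X.image (Int.cast : ℤ → ZMod a)
    · obtain ⟨w, hw, hwk⟩ := Finset.mem_image.1 h
      refine Finset.mem_union_left _ (Finset.mem_image.2 ⟨w, Finset.mem_filter.2 ⟨hw, ?_⟩, hwk⟩)
      rw [hwk]
      simpa using hk
    · exact Finset.mem_union_right _ (Finset.mem_sdiff.2
        ⟨Finset.add_mem_add (Finset.mem_image_of_mem _ hx) hk, h⟩)
  have h₃ := (Finset.card_le_card h₂).trans (Finset.card_union_le _ _)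
  rw [Finset.card_image_of_injective _ (add_right_injective _)] at h₃
  omega

lemma card_residues_add_one_le {X : Finset ℤ} (h0 : 0 ∈ X) (ha : (a : ℤ) ∈ X) :
    (X.image (Int.cast : ℤ → ZMod a)).card + 1 ≤ X.card := by
  have hpos := NeZero.pos a
  have : X.image (Int.cast : ℤ → ZMod a) ⊆
      (X.erase (a : ℤ)).image (Int.cast : ℤ → ZMod a) := by
    intro y hy
    obtain ⟨x, hx, rfl⟩ := Finset.mem_image.1 hy
    by_cases h : x = a
    · subst h
      exact Finset.mem_image.2 ⟨0, Finset.mem_erase.2 ⟨by omega, h0⟩, by simp⟩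
    · exact Finset.mem_image_of_mem _ (Finset.mem_erase.2 ⟨h, hx⟩)
  have h₁ := (Finset.card_le_card this).trans Finset.card_image_le
  have h₂ := Finset.card_erase_add_one ha
  omega

end Residues

lemma card_add_card_le_card_add_one {X Y : Finset ℤ} (hX : X.Nonempty) (hY : Y.Nonempty) :
    X.card + Y.card ≤ (X + Y).card + 1 := by
  have := cauchy_davenport_add_of_linearOrder_isCancelAdd hX hY
  omega

lemma two_mul_card_add_card_le {A B : Finset ℤ} {K : AddSubgroup ℤ} (hA : A.Nonempty)
    (hAK : ∀ x ∈ A, x ∈ K) (h0 : 0 ∈ B) {y : ℤ} (hy : y ∈ B) (hyK : y ∉ K) :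
    2 * A.card + B.card ≤ (A + B).card + 2 := by
  have h₁ := card_add_card_le_card_add_one hA (Y := B.filter (· ∈ K)) ⟨0, by simp [h0]⟩
  have h₂ := card_add_card_le_card_add_one hA (Y := B.filter (· ∉ K)) ⟨y, by simp [hy, hyK]⟩
  have h₃ := Finset.card_filter_add_card_filter_not (s := B) (· ∈ K)
  have hd : Disjoint (A + B.filter (· ∈ K)) (A + B.filter (· ∉ K)) := by
    rw [Finset.disjoint_left]
    intro x hx hx'
    obtain ⟨p, hp, q, hq, rfl⟩ := Finset.mem_add.1 hx
    obtain ⟨r, hr, s, hs, hrs⟩ := Finset.mem_add.1 hx'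
    rw [Finset.mem_filter] at hq hs
    have : p + q ∈ K := add_mem (hAK p hp) hq.2
    rw [← hrs] at this
    exact hs.2 ((add_mem_cancel_left (hAK r hr)).1 this)
  have h₄ := Finset.card_le_card (Finset.union_subset
    (Finset.add_subset_add_left (s := A) (Finset.filter_subset (· ∈ K) B))
    (Finset.add_subset_add_left (s := A) (Finset.filter_subset (· ∉ K) B)))
  rw [Finset.card_union_of_disjoint hd] at h₄
  omega

section Escape

variable {a : ℕ} [NeZero a] {A B E : Finset ℤ}

lemma card_residues_le_of_escape (H : AddSubgroup (ZMod a)) (hE : E ⊆ A + B)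
    (hEa : ∀ e ∈ E, e + a ∈ A + B) {x y : ℤ} (hx : x ∈ A) (hy : y ∈ B)
    (hxy : ∀ e ∈ E, (e : ZMod a) - (x + y) ∉ H)
    (hkn : (A.image (Int.cast : ℤ → ZMod a) + elems H).card +
        (B.image (Int.cast : ℤ → ZMod a) + elems H).card ≤
      ((A + B).image (Int.cast : ℤ → ZMod a)).card + (elems H).card) :
    (A.image (Int.cast : ℤ → ZMod a)).card +
        (B.filter (fun w : ℤ => (w : ZMod a) - y ∈ H)).card +
        (B.image (Int.cast : ℤ → ZMod a)).card + E.card ≤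
      (A + B).card + 1 +
        ((B.filter (fun w : ℤ => (w : ZMod a) - y ∈ H)).image (Int.cast : ℤ → ZMod a)).card := by
  have h₁ := card_residues_add_card_coset_le H hE hEa _ hxy
  have h₂ := card_elems_add_card_residues_le H hx
  have h₃ := card_elems_add_card_residues_le H hy
  have h₄ := card_add_card_le_card_add_one
    (X := A.filter (fun w : ℤ => (w : ZMod a) - x ∈ H)) ⟨x, by simp [hx]⟩
    (Y := B.filter (fun w : ℤ => (w : ZMod a) - y ∈ H)) ⟨y, by simp [hy]⟩
  have h₅ : A.filter (fun w : ℤ => (w : ZMod a) - x ∈ H) +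
      B.filter (fun w : ℤ => (w : ZMod a) - y ∈ H) ⊆
      (A + B).filter (fun w : ℤ => (w : ZMod a) - (x + y) ∈ H) := by
    intro z hz
    obtain ⟨p, hp, q, hq, rfl⟩ := Finset.mem_add.1 hz
    rw [Finset.mem_filter] at hp hq
    refine Finset.mem_filter.2 ⟨Finset.add_mem_add hp.1 hq.1, ?_⟩
    have := add_mem hp.2 hq.2
    rw [sub_add_sub_comm] at this
    simpa using this
  have h₆ := Finset.card_le_card h₅
  have h₇ := Finset.card_image_le (s := A.filter (fun w : ℤ => (w : ZMod a) - x ∈ H))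
    (f := (Int.cast : ℤ → ZMod a))
  omega

end Escape

lemma exists_period_set {a : ℕ} {A B : Finset ℤ} (hA0 : 0 ∈ A) (hAa : (a : ℤ) ∈ A)
    (hB0 : 0 ∈ B) :
    ∃ E : Finset ℤ, B ⊆ E ∧ E ⊆ A ∪ B ∧ E ⊆ A + B ∧ (∀ e ∈ E, e + a ∈ A + B) ∧
      B.card + (if (a : ℤ) ∈ B then 1 else 0) ≤ E.card + (if A ⊆ B then 1 else 0) := by
  have hB : B ⊆ A + B := fun b hb => Finset.mem_add.2 ⟨0, hA0, b, hb, zero_add b⟩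
  have hBa : ∀ b ∈ B, b + a ∈ A + B := fun b hb => Finset.mem_add.2 ⟨a, hAa, b, hb, add_comm _ _⟩
  by_cases h : (a : ℤ) ∈ B
  · refine ⟨A ∪ B, Finset.subset_union_right, subset_rfl, Finset.union_subset ?_ hB, ?_, ?_⟩
    · exact fun x hx => Finset.mem_add.2 ⟨x, hx, 0, hB0, add_zero x⟩
    · intro e he
      rcases Finset.mem_union.1 he with he | he
      · exact Finset.add_mem_add he h
      · exact hBa e he
    · rw [if_pos h]
      split_ifs with hAB
      · rw [Finset.union_eq_right.2 hAB]
      · exact Finset.card_lt_card ⟨Finset.subset_union_right,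
          fun h => hAB (Finset.subset_union_left.trans h)⟩
  · exact ⟨B, subset_rfl, Finset.subset_union_right, hB, hBa, by simp [h]⟩

/-- A version of the Lev–Smeliansky theorem. -/
lemma card_add_two_mul_card_le_or {a : ℕ} [NeZero a] {A B : Finset ℤ}
    (hA0 : 0 ∈ A) (hAa : (a : ℤ) ∈ A) (hA : A ⊆ Finset.Icc 0 (a : ℤ))
    (hB0 : 0 ∈ B) (hB : B ⊆ Finset.Icc 0 (a : ℤ))
    (hprim : ∀ K : AddSubgroup ℤ, (∀ x ∈ A, x ∈ K) → (∀ x ∈ B, x ∈ K) → K = ⊤)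
    (hcard : A.card + B.card ≤ a + 2) :
    A.card + 2 * B.card ≤ (A + B).card + 2 + (if A ⊆ B then 1 else 0) ∨
      2 * A.card + B.card ≤ (A + B).card + 2 := by
  obtain ⟨E, hBE, hEAB, hE, hEa, hEcard⟩ := exists_period_set hA0 hAa hB0
  have hAne : A.Nonempty := ⟨0, hA0⟩
  have hBne : B.Nonempty := ⟨0, hB0⟩
  have hCE := card_residues_add_card_le (NeZero.pos a) hE hEa
  have hAr := card_le_card_residues_add hA
  rw [if_pos hAa] at hAr
  have hBr := card_le_card_residues_add hB
  have himg : (A + B).image (Int.cast : ℤ → ZMod a) =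
      A.image (Int.cast : ℤ → ZMod a) + B.image (Int.cast : ℤ → ZMod a) :=
    Finset.image_add (Int.castAddHom (ZMod a))
  have hkn := kneser (A.image (Int.cast : ℤ → ZMod a)) (B.image (Int.cast : ℤ → ZMod a))
    (hAne.image _) (hBne.image _)
  rw [← himg] at hkn
  set H := periods ((A + B).image (Int.cast : ℤ → ZMod a)) with hH
  by_cases hAH : ∀ x ∈ A, (x : ZMod a) ∈ H
  · by_cases hBH : ∀ x ∈ B, (x : ZMod a) ∈ H
    · have hK := hprim (H.comap (Int.castAddHom (ZMod a))) hAH hBH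
      have huniv : (A + B).image (Int.cast : ℤ → ZMod a) = Finset.univ := by
        rw [Finset.eq_univ_iff_forall]
        intro z
        obtain ⟨n, rfl⟩ := ZMod.intCast_surjective z
        have hn : n ∈ H.comap (Int.castAddHom (ZMod a)) := by rw [hK]; trivial
        have h0 : (0 : ZMod a) ∈ (A + B).image (Int.cast : ℤ → ZMod a) :=
          Finset.mem_image.2 ⟨0, Finset.mem_add.2 ⟨0, hA0, 0, hB0, rfl⟩, by simp⟩
        simpa using (mem_periods.1 hn 0).2 h0
      rw [huniv, Finset.card_univ, ZMod.card] at hCE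
      left
      split_ifs at hEcard ⊢ <;> omega
    · push Not at hBH
      obtain ⟨y, hy, hyH⟩ := hBH
      right
      exact two_mul_card_add_card_le (K := H.comap (Int.castAddHom (ZMod a))) hAne hAH hB0 hy hyH
  push Not at hAH
  obtain ⟨x₁, hx₁, hx₁H⟩ := hAH
  left
  by_cases hAB' : ∀ x ∈ A, (x : ZMod a) ∈ B.image (Int.cast : ℤ → ZMod a) + elems H
  · have hlt : (elems H).card < (A.image (Int.cast : ℤ → ZMod a) + elems H).card := by
      refine Finset.card_lt_card ⟨fun k hk => Finset.mem_add.2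
        ⟨0, Finset.mem_image.2 ⟨0, hA0, by simp⟩, k, hk, zero_add k⟩, fun h => hx₁H ?_⟩
      have := h (Finset.mem_add.2 ⟨x₁, Finset.mem_image_of_mem _ hx₁, 0, by simp, add_zero _⟩)
      simpa using this
    have hex : ∃ z ∈ (A + B).image (Int.cast : ℤ → ZMod a),
        z ∉ B.image (Int.cast : ℤ → ZMod a) + elems H := by
      by_contra! h
      have := Finset.card_le_card h
      omega
    obtain ⟨z, hz, hzB⟩ := hex
    obtain ⟨c, hc, rfl⟩ := Finset.mem_image.1 hz
    obtain ⟨x, hx, y, hy, rfl⟩ := Finset.mem_add.1 hc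
    have hesc : ∀ e ∈ E, (e : ZMod a) - (x + y) ∉ H := by
      intro e he heH
      have heB : (e : ZMod a) ∈ B.image (Int.cast : ℤ → ZMod a) + elems H := by
        rcases Finset.mem_union.1 (hEAB he) with he | he
        · exact hAB' e he
        · exact Finset.mem_add.2 ⟨e, Finset.mem_image_of_mem _ he, 0, by simp, add_zero _⟩
      obtain ⟨b, hb, k, hk, hbk⟩ := Finset.mem_add.1 heB
      rw [mem_elems] at hk
      refine hzB (Finset.mem_add.2 ⟨b, hb, k - (e - (x + y)), ?_, ?_⟩)
      · rw [mem_elems]; exact sub_mem hk heH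
      · rw [← hbk]; push_cast; ring
    have := card_residues_le_of_escape H hE hEa hx hy hesc hkn
    have := Finset.card_image_le (s := B.filter (fun w : ℤ => (w : ZMod a) - y ∈ H))
      (f := (Int.cast : ℤ → ZMod a))
    omega
  · push Not at hAB'
    obtain ⟨x, hx, hxB⟩ := hAB'
    have hesc : ∀ e ∈ B, (e : ZMod a) - (x + (0 : ℤ)) ∉ H := by
      intro e he heH
      refine hxB (Finset.mem_add.2 ⟨e, Finset.mem_image_of_mem _ he, x - e, ?_, by ring⟩)
      rw [mem_elems]
      simpa using neg_mem heH
    have h₁ := card_residues_le_of_escape H (hBE.trans hE) (fun e he => hEa e (hBE he)) hx hB0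
      hesc hkn
    split_ifs at hBr with h
    · have := card_residues_add_one_le (a := a)
        (X := B.filter (fun w : ℤ => (w : ZMod a) - (0 : ℤ) ∈ H)) (by simp [hB0]) (by simp [h])
      omega
    · have := Finset.card_image_le (s := B.filter (fun w : ℤ => (w : ZMod a) - (0 : ℤ) ∈ H))
        (f := (Int.cast : ℤ → ZMod a))
      omega

section Interval

lemma card_inter_add_card_inter_le {A B : Finset ℤ} {t : ℤ} (ht : t ∉ A + B) (p q : ℤ) :
    (A ∩ Finset.Icc p q).card + (B ∩ Finset.Icc (t - q) (t - p)).card ≤ (q + 1 - p).toNat := by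
  rw [← Int.card_Icc, ← Finset.card_image_of_injective (B ∩ _) (sub_right_injective (b := t)),
    ← Finset.card_union_of_disjoint]
  · refine Finset.card_le_card (Finset.union_subset Finset.inter_subset_right fun x hx => ?_)
    obtain ⟨y, hy, rfl⟩ := Finset.mem_image.1 hx
    simp only [Finset.mem_inter, Finset.mem_Icc] at hy ⊢
    omega
  · rw [Finset.disjoint_left]
    intro x hx hx'
    obtain ⟨y, hy, rfl⟩ := Finset.mem_image.1 hx'
    exact ht (Finset.mem_add.2 ⟨_, (Finset.mem_inter.1 hx).1, y, (Finset.mem_inter.1 hy).1,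
      sub_add_cancel t y⟩)

lemma card_le_card_inter_Icc_add (X : Finset ℤ) {l p q u : ℤ} (hX : X ⊆ Finset.Icc l u) :
    X.card ≤ (X ∩ Finset.Icc l p).card + (X ∩ Finset.Icc q u).card + (q - (p + 1)).toNat := by
  have h : X ⊆ (X ∩ Finset.Icc l p) ∪ (X ∩ Finset.Icc q u) ∪ Finset.Ico (p + 1) q := by
    intro x hx
    have := Finset.mem_Icc.1 (hX hx)
    simp only [Finset.mem_union, Finset.mem_inter, Finset.mem_Icc, Finset.mem_Ico, hx, true_and]
    omega
  have h₁ := (Finset.card_le_card h).trans (Finset.card_union_le _ _)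
  have h₂ := Finset.card_union_le (X ∩ Finset.Icc l p) (X ∩ Finset.Icc q u)
  rw [Int.card_Ico] at h₁
  omega

lemma card_add_card_inter_Icc_le (X : Finset ℤ) {l p q u : ℤ} (hX : X ⊆ Finset.Icc l u)
    (hqp : q ≤ p + 1) :
    X.card + (X ∩ Finset.Icc q p).card ≤
      (X ∩ Finset.Icc l p).card + (X ∩ Finset.Icc q u).card := by
  rw [← Finset.card_union_add_card_inter (X ∩ Finset.Icc l p)]
  refine add_le_add (Finset.card_le_card fun x hx => ?_) (Finset.card_le_card fun x hx => ?_)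
  · have := Finset.mem_Icc.1 (hX hx)
    simp only [Finset.mem_union, Finset.mem_inter, Finset.mem_Icc, hx, true_and]
    omega
  · rw [Finset.mem_inter] at hx
    have h₁ := Finset.mem_Icc.1 (hX hx.1)
    have h₂ := Finset.mem_Icc.1 hx.2
    simp only [Finset.mem_inter, Finset.mem_Icc, hx.1, true_and]
    omega

variable {a b : ℤ} {A B : Finset ℤ}

lemma add_subset_Icc (hA : A ⊆ Finset.Icc 0 a) (hB : B ⊆ Finset.Icc 0 b) :
    A + B ⊆ Finset.Icc 0 (a + b) := by
  intro x hx
  obtain ⟨y, hy, z, hz, rfl⟩ := Finset.mem_add.1 hx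
  have := Finset.mem_Icc.1 (hA hy)
  have := Finset.mem_Icc.1 (hB hz)
  rw [Finset.mem_Icc]
  omega

lemma mem_add_or_add_mem_add (hA : A ⊆ Finset.Icc 0 a) (hB : B ⊆ Finset.Icc 0 b) (hba : b ≤ a)
    (hcard : a + 3 ≤ A.card + B.card) {t : ℤ} (h0 : 0 ≤ t) (hta : t ≤ a) :
    t ∈ A + B ∨ t + a ∈ A + B := by
  by_contra! h
  have h₁ := card_inter_add_card_inter_le h.1 0 t
  have h₂ := card_inter_add_card_inter_le h.2 t a
  have h₃ := card_le_card_inter_Icc_add A (p := t) (q := t) hA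
  have h₄ := card_le_card_inter_Icc_add B (p := t) (q := t)
    (hB.trans (Finset.Icc_subset_Icc_right hba))
  simp only [sub_self, sub_zero, add_sub_cancel_right, add_sub_cancel_left] at h₁ h₂
  omega

lemma mem_add_of_mem_Icc (hA : A ⊆ Finset.Icc 0 a) (hB : B ⊆ Finset.Icc 0 b) (hb : 0 ≤ b)
    (hcard : a + 3 ≤ A.card + B.card) {t : ℤ} (hbt : b ≤ t) (hta : t ≤ a) :
    t ∈ A + B := by
  by_contra! h
  have h₁ := card_inter_add_card_inter_le h (t - b) t
  simp only [sub_self, sub_sub_cancel] at h₁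
  rw [Finset.inter_eq_left.2 hB] at h₁
  have h₂ := card_le_card_inter_Icc_add A (p := t) (q := t + 1) hA
  have h₃ := card_le_card_inter_Icc_add (A ∩ Finset.Icc 0 t) (p := t - b - 1) (q := t - b)
    Finset.inter_subset_right
  have h₄ : (A ∩ Finset.Icc 0 t ∩ Finset.Icc 0 (t - b - 1)).card ≤ (t - b).toNat := by
    refine (Finset.card_le_card Finset.inter_subset_right).trans ?_
    rw [Int.card_Icc]; omega
  have h₅ : (A ∩ Finset.Icc (t + 1) a).card ≤ (a - t).toNat := by
    refine (Finset.card_le_card Finset.inter_subset_right).trans ?_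
    rw [Int.card_Icc]; omega
  have h₆ : (A ∩ Finset.Icc 0 t ∩ Finset.Icc (t - b) t).card ≤
      (A ∩ Finset.Icc (t - b) t).card :=
    Finset.card_le_card (Finset.inter_subset_inter_right Finset.inter_subset_left)
  omega

/-- The elements of `[0, a]` both of whose translates by `0` and `a` lie in `C`. -/
noncomputable def doubled (a : ℤ) (C : Finset ℤ) : Finset ℤ :=
  (Finset.Icc 0 a).filter (fun t => t ∈ C ∧ t + a ∈ C)

lemma mem_doubled {C : Finset ℤ} {t : ℤ} :
    t ∈ doubled a C ↔ (0 ≤ t ∧ t ≤ a) ∧ t ∈ C ∧ t + a ∈ C := by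
  simp [doubled]

lemma card_add_eq (ha : 0 ≤ a) (hAa : a ∈ A) (hA : A ⊆ Finset.Icc 0 a)
    (hB0 : 0 ∈ B) (hB : B ⊆ Finset.Icc 0 b) (hba : b ≤ a)
    (hcard : a + 3 ≤ A.card + B.card) :
    ((A + B).card : ℤ) = a + (doubled a (A + B)).card := by
  set C := A + B with hC
  have hsub := add_subset_Icc hA hB
  have haC : a ∈ C := Finset.mem_add.2 ⟨a, hAa, 0, hB0, add_zero a⟩
  set C₁ := C ∩ Finset.Icc 0 a with hC₁
  set C₂ := (C ∩ Finset.Icc a (a + a)).image (fun x => x - a) with hC₂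
  have hmem₂ : ∀ t, t ∈ C₂ ↔ t + a ∈ C ∧ 0 ≤ t ∧ t ≤ a := by
    intro t
    simp only [hC₂, Finset.mem_image, Finset.mem_inter, Finset.mem_Icc]
    constructor
    · rintro ⟨x, ⟨hx, hx'⟩, rfl⟩
      rw [sub_add_cancel]
      exact ⟨hx, by omega, by omega⟩
    · rintro ⟨h, h₁, h₂⟩
      exact ⟨t + a, ⟨h, by omega, by omega⟩, by omega⟩
  have hunion : C₁ ∪ C₂ = Finset.Icc 0 a := by
    ext t
    rw [Finset.mem_union, hmem₂, hC₁, Finset.mem_inter, Finset.mem_Icc]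
    have := fun h₁ h₂ => mem_add_or_add_mem_add hA hB hba hcard (t := t) h₁ h₂
    tauto
  have hinter : C₁ ∩ C₂ = doubled a C := by
    ext t
    rw [Finset.mem_inter, hmem₂, hC₁, Finset.mem_inter, Finset.mem_Icc, mem_doubled]
    tauto
  have hcard₂ : C₂.card = (C ∩ Finset.Icc a (a + a)).card :=
    Finset.card_image_of_injective _ (sub_left_injective (b := a))
  have h₁ := Finset.card_union_add_card_inter C₁ C₂
  rw [hunion, hinter, Int.card_Icc, hcard₂] at h₁
  have h₂ := Finset.card_union_add_card_inter C₁ (C ∩ Finset.Icc a (a + a))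
  have h₃ : C₁ ∪ (C ∩ Finset.Icc a (a + a)) = C := by
    ext x
    simp only [hC₁, Finset.mem_union, Finset.mem_inter, Finset.mem_Icc]
    constructor
    · tauto
    · intro hx
      have := Finset.mem_Icc.1 (hsub hx)
      simp only [hx, true_and]
      omega
  have h₄ : C₁ ∩ (C ∩ Finset.Icc a (a + a)) = {a} := by
    ext x
    simp only [hC₁, Finset.mem_inter, Finset.mem_Icc, Finset.mem_singleton]
    constructor
    · omega
    · rintro rfl
      simp only [haC, true_and]
      omega
  rw [h₃, h₄, Finset.card_singleton] at h₂
  omega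

lemma subset_doubled (hA0 : 0 ∈ A) (hAa : a ∈ A) (hB : B ⊆ Finset.Icc 0 b) (hba : b ≤ a) :
    B ⊆ doubled a (A + B) := by
  intro t ht
  have := Finset.mem_Icc.1 (hB ht)
  exact mem_doubled.2 ⟨by omega, Finset.mem_add.2 ⟨0, hA0, t, ht, zero_add t⟩,
    Finset.mem_add.2 ⟨a, hAa, t, ht, add_comm _ _⟩⟩

lemma length_add_card_le (hb : 0 ≤ b) (hAa : a ∈ A) (hA : A ⊆ Finset.Icc 0 a)
    (hB0 : 0 ∈ B) (hBb : b ∈ B) (hB : B ⊆ Finset.Icc 0 b) (hba : b ≤ a)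
    (hcard : a + 3 ≤ A.card + B.card) :
    b + A.card ≤ ((A + B).card : ℤ) := by
  rw [card_add_eq (hb.trans hba) hAa hA hB0 hB hba hcard]
  have hinj : (Finset.Icc 0 b \ doubled a (A + B)).card ≤ (Finset.Icc 0 a \ A).card := by
    refine Finset.card_le_card_of_injOn (fun t => if t ∈ A + B then t + a - b else t) ?_ ?_
    · intro t ht
      simp only [Finset.coe_sdiff, Set.mem_sdiff, Finset.mem_coe, Finset.mem_Icc,
        mem_doubled] at ht ⊢
      split_ifs with h
      · refine ⟨by omega, fun h' => ht.2 ⟨by omega, h, ?_⟩⟩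
        exact Finset.mem_add.2 ⟨_, h', b, hBb, by ring⟩
      · exact ⟨by omega, fun h' => h (Finset.mem_add.2 ⟨t, h', 0, hB0, add_zero t⟩)⟩
    · have key : ∀ t u : ℤ, 0 ≤ t → t ≤ b → 0 ≤ u → u ≤ b → t ∉ A + B → u + a ∉ A + B →
          t ≠ u + a - b := by
        rintro t u h0 htb hu hub ht hua rfl
        have h₁ := card_inter_add_card_inter_le ht 0 (u + a - b)
        have h₂ := card_inter_add_card_inter_le hua (u + a - b) a
        have h₃ := card_le_card_inter_Icc_add A (p := u + a - b) (q := u + a - b) hA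
        have h₄ := card_le_card_inter_Icc_add B (p := u + a - b) (q := u) hB
        rw [show u + a - (u + a - b) = b by ring, show u + a - a = u by ring] at h₂
        simp only [sub_self, sub_zero] at h₁
        omega
      intro t ht u hu htu
      simp only [Finset.coe_sdiff, Set.mem_sdiff, Finset.mem_coe, Finset.mem_Icc,
        mem_doubled] at ht hu
      have ht' : t ∈ A + B → t + a ∉ A + B := fun h h' => ht.2 ⟨by omega, h, h'⟩
      have hu' : u ∈ A + B → u + a ∉ A + B := fun h h' => hu.2 ⟨by omega, h, h'⟩
      simp only at htu
      split_ifs at htu with h₁ h₂ h₂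
      · omega
      · exact absurd htu.symm (key u t hu.1.1 hu.1.2 ht.1.1 ht.1.2 h₂ (ht' h₁))
      · exact absurd htu (key t u ht.1.1 ht.1.2 hu.1.1 hu.1.2 h₁ (hu' h₂))
      · exact htu
  have h₁ := Finset.card_sdiff_add_card_eq_card hA
  have h₂ : (Finset.Icc 0 b).card ≤
      (Finset.Icc 0 b \ doubled a (A + B)).card + (doubled a (A + B)).card := by
    refine (Finset.card_le_card ?_).trans (Finset.card_union_le _ _)
    intro x hx
    by_cases h : x ∈ doubled a (A + B) <;> simp [h, Finset.mem_Icc.1 hx]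
  rw [Int.card_Icc] at h₁ h₂
  omega

lemma not_hole_of_adjacent (hb : 0 ≤ b) (hA0 : 0 ∈ A) (hAa : a ∈ A) (hA : A ⊆ Finset.Icc 0 a)
    (hB0 : 0 ∈ B) (hBb : b ∈ B) (hB : B ⊆ Finset.Icc 0 b) (hba : b ≤ a)
    (hcard : a + 3 ≤ A.card + B.card)
    (hsum : ((A + B).card : ℤ) ≤ A.card + 2 * B.card - 3)
    (hsum' : A ⊆ B → ((A + B).card : ℤ) ≤ A.card + 2 * B.card - 4)
    {u v : ℤ} (hu : 0 ≤ u) (huv : u < v) (hvb : v ≤ b)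
    (hmid : ∀ t, u < t → t < v → t ∈ A + B ∧ t + a ∈ A + B)
    (hvC : v ∉ A + B) (huC : u + a ∉ A + B) : False := by
  have hC := card_add_eq (hb.trans hba) hAa hA hB0 hB hba hcard
  have hBD := subset_doubled hA0 hAa hB hba
  have p₁ := card_inter_add_card_inter_le hvC 0 v
  have p₂ := card_inter_add_card_inter_le huC (u + a - b) a
  rw [sub_self, sub_zero] at p₁
  rw [show u + a - (u + a - b) = b by ring, show u + a - a = u by ring] at p₂
  have hBs := card_add_card_inter_Icc_le B (p := v) (q := u) hB (by omega)
  have hAs := card_le_card_inter_Icc_add A (p := v) (q := u + a - b) hA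
  have hD : ∀ S : Finset ℤ, S ⊆ doubled a (A + B) → S ∩ Finset.Icc u v = ∅ →
      (S.card : ℤ) + (v - u - 1) ≤ (doubled a (A + B)).card := by
    intro S hS hSuv
    have hd : Disjoint S (Finset.Ioo u v) := by
      rw [Finset.disjoint_left]
      intro x hx hx'
      have : x ∈ S ∩ Finset.Icc u v := Finset.mem_inter.2 ⟨hx, Finset.Ioo_subset_Icc_self hx'⟩
      simp [hSuv] at this
    have hsub : S ∪ Finset.Ioo u v ⊆ doubled a (A + B) := by
      refine Finset.union_subset hS fun t ht => ?_
      rw [Finset.mem_Ioo] at ht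
      exact mem_doubled.2 ⟨by omega, hmid t ht.1 ht.2⟩
    have := Finset.card_le_card hsub
    rw [Finset.card_union_of_disjoint hd, Int.card_Ioo] at this
    omega
  have hBc := Finset.card_sdiff_add_card_inter B (Finset.Icc u v)
  have hD₁ := hD (B \ Finset.Icc u v) (Finset.sdiff_subset.trans hBD) (by simp)
  rcases lt_or_ge (v + 1) (u + a - b) with hlt | hge
  · omega
  have hAs' := card_add_card_inter_Icc_le A (p := v) (q := u + a - b) hA hge
  have hab : a = b := by omega
  subst hab
  rw [add_sub_cancel_right u a] at hAs' p₂
  have hAuv : A ∩ Finset.Icc u v = ∅ := by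
    rw [← Finset.card_eq_zero]
    omega
  by_cases hAB : A ⊆ B
  · have := hsum' hAB
    omega
  obtain ⟨x, hxA, hxB⟩ := Finset.not_subset.1 hAB
  have hxuv : x ∉ Finset.Icc u v := fun h => by
    have : x ∈ A ∩ Finset.Icc u v := Finset.mem_inter.2 ⟨hxA, h⟩
    simp [hAuv] at this
  have hxD : x ∈ doubled a (A + B) := by
    have := Finset.mem_Icc.1 (hA hxA)
    exact mem_doubled.2 ⟨this, Finset.mem_add.2 ⟨x, hxA, 0, hB0, add_zero x⟩,
      Finset.add_mem_add hxA hBb⟩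
  have hD₂ := hD (insert x (B \ Finset.Icc u v))
    (Finset.insert_subset hxD (Finset.sdiff_subset.trans hBD)) (by
      rw [Finset.insert_inter_of_notMem hxuv]; simp)
  rw [Finset.card_insert_of_notMem (by simp [hxB])] at hD₂
  omega

lemma not_hole_of_lt (hb : 0 ≤ b) (hA0 : 0 ∈ A) (hAa : a ∈ A) (hA : A ⊆ Finset.Icc 0 a)
    (hB0 : 0 ∈ B) (hBb : b ∈ B) (hB : B ⊆ Finset.Icc 0 b) (hba : b ≤ a)
    (hcard : a + 3 ≤ A.card + B.card)
    (hsum : ((A + B).card : ℤ) ≤ A.card + 2 * B.card - 3)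
    (hsum' : A ⊆ B → ((A + B).card : ℤ) ≤ A.card + 2 * B.card - 4) (n : ℕ) :
    ∀ u v : ℤ, (v - u).toNat = n → 0 ≤ u → u < v → v ≤ b → v ∉ A + B → u + a ∉ A + B → False := by
  induction n using Nat.strong_induction_on with
  | _ n ih =>
  intro u v hn hu huv hvb hvC huC
  refine not_hole_of_adjacent hb hA0 hAa hA hB0 hBb hB hba hcard hsum hsum' hu huv hvb ?_ hvC huC
  intro t hut htv
  constructor
  · by_contra h
    exact ih (t - u).toNat (by omega) u t rfl hu hut (by omega) h huC
  · by_contra h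
    exact ih (v - t).toNat (by omega) t v rfl (by omega) htv hvb hvC h

lemma exists_Icc_subset_add (hb : 0 ≤ b) (hA0 : 0 ∈ A) (hAa : a ∈ A) (hA : A ⊆ Finset.Icc 0 a)
    (hB0 : 0 ∈ B) (hBb : b ∈ B) (hB : B ⊆ Finset.Icc 0 b) (hba : b ≤ a)
    (hcard : a + 3 ≤ A.card + B.card)
    (hsum : ((A + B).card : ℤ) ≤ A.card + 2 * B.card - 3)
    (hsum' : A ⊆ B → ((A + B).card : ℤ) ≤ A.card + 2 * B.card - 4) :
    ∃ x : ℤ, Finset.Icc x (x + A.card + B.card - 2) ⊆ A + B := by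
  obtain ⟨p, ⟨hp, hpb, hpC⟩, hpmax⟩ : ∃ p : ℤ, (-1 ≤ p ∧ p ≤ b ∧ p ∉ A + B) ∧
      ∀ t, p < t → t ≤ b → t ∈ A + B := by
    have hm : (-1 : ℤ) ∈ Finset.Icc (-1) b \ (A + B) := by
      refine Finset.mem_sdiff.2 ⟨by simp; omega, fun h => ?_⟩
      have := Finset.mem_Icc.1 (add_subset_Icc hA hB h)
      omega
    obtain ⟨p, hp, hmax⟩ := Finset.exists_max_image _ id ⟨_, hm⟩
    simp only [Finset.mem_sdiff, Finset.mem_Icc, id] at hp hmax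
    refine ⟨p, ⟨hp.1.1, hp.1.2, hp.2⟩, fun t h₁ h₂ => ?_⟩
    by_contra h
    have := hmax t ⟨⟨by omega, h₂⟩, h⟩
    omega
  obtain ⟨q, ⟨hq, hqb, hqC⟩, hqmin⟩ : ∃ q : ℤ, (a ≤ q ∧ q ≤ a + b + 1 ∧ q ∉ A + B) ∧
      ∀ t, t < q → a ≤ t → t ∈ A + B := by
    have hm : a + b + 1 ∈ Finset.Icc a (a + b + 1) \ (A + B) := by
      refine Finset.mem_sdiff.2 ⟨by simp; omega, fun h => ?_⟩
      have := Finset.mem_Icc.1 (add_subset_Icc hA hB h)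
      omega
    obtain ⟨q, hq, hmin⟩ := Finset.exists_min_image _ id ⟨_, hm⟩
    simp only [Finset.mem_sdiff, Finset.mem_Icc, id] at hq hmin
    refine ⟨q, ⟨hq.1.1, hq.1.2, hq.2⟩, fun t h₁ h₂ => ?_⟩
    by_contra h
    have := hmin t ⟨⟨by omega, by omega⟩, h⟩
    omega
  have hlt : p < q - a := by
    by_contra! h
    rcases h.lt_or_eq with h | h
    · exact not_hole_of_lt hb hA0 hAa hA hB0 hBb hB hba hcard hsum hsum' _ (q - a) p rfl
        (by omega) h hpb hpC (by rwa [sub_add_cancel])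
    · rcases mem_add_or_add_mem_add hA hB hba hcard (t := p) (by omega) (by omega) with h' | h'
      · exact hpC h'
      · exact hqC (by rwa [show q = p + a by omega])
  have h₁ := card_inter_add_card_inter_le hpC 0 p
  have h₂ := card_inter_add_card_inter_le hqC (q - b) a
  rw [sub_self, sub_zero] at h₁
  rw [sub_sub_cancel] at h₂
  have h₃ := card_le_card_inter_Icc_add A (p := p) (q := q - b) hA
  have h₄ := card_le_card_inter_Icc_add B (p := p) (q := q - a) hB
  refine ⟨p + 1, fun t ht => ?_⟩
  rw [Finset.mem_Icc] at ht
  rcases le_or_gt t b with h | h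
  · exact hpmax t (by omega) h
  rcases le_or_gt a t with h' | h'
  · exact hqmin t (by omega) h'
  · exact mem_add_of_mem_Icc hA hB hb hcard h.le h'.le

end Interval

section Assembly

lemma structure_of_normalized {a b : ℤ} {A B : Finset ℤ}
    (hA0 : 0 ∈ A) (hAa : a ∈ A) (hA : A ⊆ Finset.Icc 0 a)
    (hB0 : 0 ∈ B) (hBb : b ∈ B) (hB : B ⊆ Finset.Icc 0 b) (hba : b ≤ a)
    (hprim : ∀ K : AddSubgroup ℤ, (∀ x ∈ A, x ∈ K) → (∀ x ∈ B, x ∈ K) → K = ⊤)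
    (hsum : ((A + B).card : ℤ) ≤ A.card + 2 * B.card - 3)
    (hsum₂ : ((A + B).card : ℤ) ≤ 2 * A.card + B.card - 3)
    (hsum' : A ⊆ B → ((A + B).card : ℤ) ≤ A.card + 2 * B.card - 4) :
    a + B.card ≤ ((A + B).card : ℤ) ∧ b + A.card ≤ ((A + B).card : ℤ) ∧
      ∃ x : ℤ, Finset.Icc x (x + A.card + B.card - 2) ⊆ A + B := by
  have hb : 0 ≤ b := (Finset.mem_Icc.1 (hB hB0)).2
  have hcard : a + 3 ≤ A.card + B.card := by
    by_contra! h
    have h₁ := card_add_card_le_card_add_one ⟨0, hA0⟩ ⟨0, hB0⟩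
    have h₂ := Finset.card_le_card hA
    rw [Int.card_Icc] at h₂
    lift a to ℕ using hb.trans hba
    have : NeZero a := ⟨by omega⟩
    rcases card_add_two_mul_card_le_or hA0 hAa hA hB0
      (hB.trans (Finset.Icc_subset_Icc_right hba)) hprim (by omega) with h | h
    · split_ifs at h with hAB
      · have := hsum' hAB
        omega
      · omega
    · omega
  refine ⟨?_, length_add_card_le hb hAa hA hB0 hBb hB hba hcard,
    exists_Icc_subset_add hb hA0 hAa hA hB0 hBb hB hba hcard hsum hsum'⟩
  rw [card_add_eq (hb.trans hba) hAa hA hB0 hB hba hcard]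
  have := Finset.card_le_card (subset_doubled hA0 hAa hB hba)
  omega

lemma exists_primitive_normalization {A B : Finset ℤ} {α β : ℤ} (hα : α ∈ A) (hβ : β ∈ B)
    (hA : 1 < A.card) :
    ∃ (q : ℤ) (A' B' : Finset ℤ), 0 < q ∧ A = A'.image (fun x => α + q * x) ∧
      B = B'.image (fun x => β + q * x) ∧ 0 ∈ A' ∧ 0 ∈ B' ∧
      ∀ K : AddSubgroup ℤ, (∀ x ∈ A', x ∈ K) → (∀ x ∈ B', x ∈ K) → K = ⊤ := by
  set S : Finset ℤ := A.image (fun x => x - α) ∪ B.image (fun x => x - β) with hS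
  set q : ℤ := S.gcd id with hq
  have hdA : ∀ x ∈ A, q ∣ x - α := fun x hx => Finset.gcd_dvd (f := id)
    (Finset.mem_union_left _ (Finset.mem_image_of_mem _ hx))
  have hdB : ∀ x ∈ B, q ∣ x - β := fun x hx => Finset.gcd_dvd (f := id)
    (Finset.mem_union_right _ (Finset.mem_image_of_mem _ hx))
  have hq0 : 0 < q := by
    refine lt_of_le_of_ne (Int.nonneg_of_normalize_eq_self Finset.normalize_gcd) fun h => ?_
    obtain ⟨x, hx, hxα⟩ := Finset.exists_mem_ne hA α
    have := hdA x hx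
    rw [← h, zero_dvd_iff] at this
    omega
  have himg : ∀ (X : Finset ℤ) (γ : ℤ), (∀ x ∈ X, q ∣ x - γ) →
      X = (X.image (fun x => (x - γ) / q)).image (fun x => γ + q * x) := by
    intro X γ h
    rw [Finset.image_image]
    conv_lhs => rw [← Finset.image_id (s := X)]
    refine Finset.image_congr fun x hx => ?_
    simp [Int.mul_ediv_cancel' (h x hx)]
  refine ⟨q, A.image (fun x => (x - α) / q), B.image (fun x => (x - β) / q), hq0,
    himg A α hdA, himg B β hdB, Finset.mem_image.2 ⟨α, hα, by simp⟩,
    Finset.mem_image.2 ⟨β, hβ, by simp⟩, fun K hKA hKB => ?_⟩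
  obtain ⟨d, rfl⟩ := Int.subgroup_cyclic K
  have hdvd : q * d ∣ q := by
    refine Finset.dvd_gcd fun s hs => ?_
    rcases Finset.mem_union.1 hs with hs | hs
    · obtain ⟨x, hx, rfl⟩ := Finset.mem_image.1 hs
      have h := hKA _ (Finset.mem_image_of_mem _ hx)
      rw [← AddSubgroup.zmultiples_eq_closure, Int.mem_zmultiples_iff] at h
      have := mul_dvd_mul_left q h
      rwa [Int.mul_ediv_cancel' (hdA x hx)] at this
    · obtain ⟨x, hx, rfl⟩ := Finset.mem_image.1 hs
      have h := hKB _ (Finset.mem_image_of_mem _ hx)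
      rw [← AddSubgroup.zmultiples_eq_closure, Int.mem_zmultiples_iff] at h
      have := mul_dvd_mul_left q h
      rwa [Int.mul_ediv_cancel' (hdB x hx)] at this
  have hd : d ∣ 1 := by
    have : q * d ∣ q * 1 := by rwa [mul_one]
    exact (mul_dvd_mul_iff_left hq0.ne').1 this
  rw [← AddSubgroup.zmultiples_eq_closure, eq_top_iff]
  intro x _
  rw [Int.mem_zmultiples_iff]
  exact hd.trans (one_dvd x)

lemma subset_progression {X X' : Finset ℤ} {γ q c : ℤ} (hX : X = X'.image (fun x => γ + q * x))
    (hX' : X' ⊆ Finset.Icc 0 c) :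
    X ⊆ (Finset.range (c + 1).toNat).image (fun i : ℕ => γ + q * (i : ℤ)) := by
  intro x hx
  rw [hX] at hx
  obtain ⟨y, hy, rfl⟩ := Finset.mem_image.1 hx
  have := Finset.mem_Icc.1 (hX' hy)
  refine Finset.mem_image.2 ⟨y.toNat, ?_, ?_⟩
  · rw [Finset.mem_range]; omega
  · rw [Int.toNat_of_nonneg this.1]

lemma freiman_of_length_le {A B : Finset ℤ} (hA : A.Nonempty) (hB : B.Nonempty)
    (hlen : B.max' hB - B.min' hB ≤ A.max' hA - A.min' hA)
    (hsum : ((A + B).card : ℤ) ≤ A.card + 2 * B.card - 3)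
    (hsum₂ : ((A + B).card : ℤ) ≤ 2 * A.card + B.card - 3)
    (hsum' : (∃ t : ℤ, A.image (fun x => t + x) ⊆ B) →
      ((A + B).card : ℤ) ≤ A.card + 2 * B.card - 4) :
    ∃ (q : ℤ), q ≠ 0 ∧ ∃ (a₁ a₂ a₃ : ℤ) (m₁ m₂ m₃ : ℕ),
      A ⊆ (Finset.range m₁).image (fun i : ℕ => a₁ + q * (i : ℤ)) ∧
      B ⊆ (Finset.range m₂).image (fun i : ℕ => a₂ + q * (i : ℤ)) ∧
      (Finset.range m₃).image (fun i : ℕ => a₃ + q * (i : ℤ)) ⊆ A + B ∧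
      (m₁ : ℤ) ≤ ((A + B).card : ℤ) - (B.card : ℤ) + 1 ∧
      (m₂ : ℤ) ≤ ((A + B).card : ℤ) - (A.card : ℤ) + 1 ∧
      (m₃ : ℤ) ≥ (A.card : ℤ) + (B.card : ℤ) - 1 := by
  have hAB := card_add_card_le_card_add_one hA hB
  obtain ⟨q, A', B', hq, hAA', hBB', hA0, hB0, hprim⟩ :=
    exists_primitive_normalization (A.min'_mem hA) (B.min'_mem hB) (by omega)
  set α := A.min' hA with hα
  set β := B.min' hB with hβ
  have hinj : ∀ γ : ℤ, Function.Injective (fun x : ℤ => γ + q * x) := fun γ x y h => by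
    simpa [hq.ne'] using h
  have hbound : ∀ (X X' : Finset ℤ) (hX : X.Nonempty),
      X = X'.image (fun x => X.min' hX + q * x) →
      ∃ c ∈ X', X.max' hX - X.min' hX = q * c ∧ X' ⊆ Finset.Icc 0 c := by
    intro X X' hX h
    have hmem : ∀ x ∈ X', X.min' hX + q * x ∈ X := fun x hx =>
      (Finset.ext_iff.1 h _).2 (Finset.mem_image_of_mem _ hx)
    obtain ⟨c, hc, hcm⟩ := Finset.mem_image.1 ((Finset.ext_iff.1 h _).1 (X.max'_mem hX))
    refine ⟨c, hc, by omega, fun x hx => Finset.mem_Icc.2 ⟨?_, ?_⟩⟩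
    · have := X.min'_le _ (hmem x hx)
      nlinarith
    · have := X.le_max' _ (hmem x hx)
      exact le_of_mul_le_mul_left (by omega) hq
  obtain ⟨a, hAa, ha, hAI⟩ := hbound A A' hA hAA'
  obtain ⟨b, hBb, hb, hBI⟩ := hbound B B' hB hBB'
  rw [ha, hb] at hlen
  have hba : b ≤ a := le_of_mul_le_mul_left hlen hq
  have hsumset : A + B = (A' + B').image (fun x => (α + β) + q * x) := by
    conv_lhs => rw [hAA', hBB']
    ext x
    simp only [Finset.mem_add, Finset.mem_image]
    constructor
    · rintro ⟨_, ⟨y, hy, rfl⟩, _, ⟨z, hz, rfl⟩, rfl⟩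
      exact ⟨_, ⟨y, hy, z, hz, rfl⟩, by ring⟩
    · rintro ⟨_, ⟨y, hy, z, hz, rfl⟩, rfl⟩
      exact ⟨_, ⟨y, hy, rfl⟩, _, ⟨z, hz, rfl⟩, by ring⟩
  have hcA : A.card = A'.card := by
    conv_lhs => rw [hAA', Finset.card_image_of_injective _ (hinj _)]
  have hcB : B.card = B'.card := by
    conv_lhs => rw [hBB', Finset.card_image_of_injective _ (hinj _)]
  have hcC : (A + B).card = (A' + B').card := by
    rw [hsumset, Finset.card_image_of_injective _ (hinj _)]
  have htrans : A' ⊆ B' → ∃ t : ℤ, A.image (fun x => t + x) ⊆ B := by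
    intro h
    refine ⟨β - α, fun x hx => ?_⟩
    obtain ⟨y, hy, rfl⟩ := Finset.mem_image.1 hx
    rw [hAA'] at hy
    obtain ⟨z, hz, rfl⟩ := Finset.mem_image.1 hy
    rw [hBB']
    exact Finset.mem_image.2 ⟨z, h hz, by ring⟩
  rw [hcC, hcA, hcB] at hsum hsum₂ hsum'
  obtain ⟨h₁, h₂, x, h₃⟩ := structure_of_normalized hA0 hAa hAI hB0 hBb hBI hba hprim hsum hsum₂
    (fun h => hsum' (htrans h))
  refine ⟨q, hq.ne', α, β, α + β + q * x, (a + 1).toNat, (b + 1).toNat, A.card + B.card - 1,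
    subset_progression hAA' hAI, subset_progression hBB' hBI, ?_, ?_, ?_, ?_⟩
  · intro z hz
    obtain ⟨i, hi, rfl⟩ := Finset.mem_image.1 hz
    rw [Finset.mem_range] at hi
    rw [hsumset]
    exact Finset.mem_image.2 ⟨x + i, h₃ (Finset.mem_Icc.2 ⟨by omega, by omega⟩), by ring⟩
  · have := Finset.mem_Icc.1 (hAI hA0)
    omega
  · have := Finset.mem_Icc.1 (hBI hB0)
    omega
  · have := hA.card_pos
    omega

end Assembly

end Freiman

/-- Theorem 1.1 (Freiman `3k-4`): if `|B| ≤ |A|` and `|A+B| ≤ |A| + 2|B| - 3 - δ`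
(with `δ = 1` if `A` is a translate of `B`, `δ = 0` otherwise), then `A`, `B` are
contained in, and `A+B` contains, arithmetic progressions of a common difference `q`
with the stated size bounds. -/
theorem freiman_3k4 (A B : Finset ℤ) (hA : A.Nonempty) (hB : B.Nonempty)
    (hBA : B.card ≤ A.card)
    (hsum : ((A + B).card : ℤ) ≤ (A.card : ℤ) + 2 * (B.card : ℤ) - 3 -
      (if ∃ t : ℤ, A = B.image (fun b => t + b) then 1 else 0)) :
    ∃ (q : ℤ), q ≠ 0 ∧ ∃ (a₁ a₂ a₃ : ℤ) (m₁ m₂ m₃ : ℕ),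
      A ⊆ (Finset.range m₁).image (fun i : ℕ => a₁ + q * (i : ℤ)) ∧
      B ⊆ (Finset.range m₂).image (fun i : ℕ => a₂ + q * (i : ℤ)) ∧
      (Finset.range m₃).image (fun i : ℕ => a₃ + q * (i : ℤ)) ⊆ A + B ∧
      (m₁ : ℤ) ≤ ((A + B).card : ℤ) - (B.card : ℤ) + 1 ∧
      (m₂ : ℤ) ≤ ((A + B).card : ℤ) - (A.card : ℤ) + 1 ∧
      (m₃ : ℤ) ≥ (A.card : ℤ) + (B.card : ℤ) - 1 := by
  have hsum₁ : ((A + B).card : ℤ) ≤ (A.card : ℤ) + 2 * (B.card : ℤ) - 3 := by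
    split_ifs at hsum <;> omega
  rcases le_or_gt (B.max' hB - B.min' hB) (A.max' hA - A.min' hA) with hlen | hlen
  · refine Freiman.freiman_of_length_le hA hB hlen hsum₁ (by omega) ?_
    rintro ⟨t, ht⟩
    have himg : A.image (fun x => t + x) = B := by
      refine Finset.eq_of_subset_of_card_le ht ?_
      rwa [Finset.card_image_of_injective _ (add_right_injective t)]
    rw [if_pos ⟨-t, by rw [← himg, Finset.image_image]; simp [Function.comp_def]⟩] at hsum
    omega
  · rw [add_comm A B] at hsum₁ ⊢
    obtain ⟨q, hq, a₁, a₂, a₃, m₁, m₂, m₃, h₁, h₂, h₃, h₄, h₅, h₆⟩ :=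
      Freiman.freiman_of_length_le hB hA hlen.le (by omega) (by omega) (by
        rintro ⟨t, ht⟩
        have hmax := A.le_max' _ (ht (Finset.mem_image_of_mem _ (B.max'_mem hB)))
        have hmin := A.min'_le _ (ht (Finset.mem_image_of_mem _ (B.min'_mem hB)))
        omega)
    exact ⟨q, hq, a₂, a₁, a₃, m₂, m₁, m₃, h₂, h₁, h₃, h₅, h₄, by omega⟩
end
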